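/- Let D₂ = {d > 1 squarefree, d ≢ 1 mod 4 : every odd prime p | d satisfies (2/p) = 1} and let D₂(X) = D₂ ∩ [1, X]. Then |D₂(X)| = (2C₂/3)·X/√(log X) + O(X/(log X)^{3/2}), where C₂ = (1/√π)·lim_{s→1⁺} ( √(s−1) · ∏_{p ∈ P₂} (1 + p^{−s}) ) and P₂ is the set of primes p such that p = 2 or (2/p) = 1. -/

import Mathlib

open Filter Asymptotics

/-- The set `D₂` of squarefree `d > 1` with `d ≢ 1 (mod 4)` all of whose odd prime
divisors `p` satisfy `(2/p) = 1`. -/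
def Dtwo : Set ℕ :=
  {d : ℕ | 1 < d ∧ Squarefree d ∧ d % 4 ≠ 1 ∧
    ∀ p : ℕ, p.Prime → Odd p → p ∣ d → jacobiSym 2 p = 1}

section PartA1

open Complex Filter Topology

lemma rpow_diff_bound {X x : ℝ} (hX : 1 ≤ X) (hx : X ≤ x) (hx1 : x ≤ X + 1) {s : ℂ}
    (hs : 119/120 < s.re) :
    ‖(X:ℂ)^(-s) - (x:ℂ)^(-s)‖ ≤ 2 * ‖s‖^((1:ℝ)/60) * X^(-(121/120:ℝ)) := by
  have hX0 : 0 < X := by linarith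
  have hx0 : 0 < x := by linarith
  set D := ‖(X:ℂ)^(-s) - (x:ℂ)^(-s)‖ with hD
  have h1 : D ≤ 2 * X^(-s.re) := by
    calc D ≤ ‖(X:ℂ)^(-s)‖ + ‖(x:ℂ)^(-s)‖ := norm_sub_le _ _
      _ = X^(-s.re) + x^(-s.re) := by
        rw [norm_cpow_eq_rpow_re_of_pos hX0, norm_cpow_eq_rpow_re_of_pos hx0]; simp
      _ ≤ X^(-s.re) + X^(-s.re) := by
        gcongr 1
        exact Real.rpow_le_rpow_of_nonpos hX0 hx (by linarith)
      _ = _ := by ring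
  have h2 : D ≤ ‖s‖ * X^(-s.re - 1) := by
    have key := Convex.norm_image_sub_le_of_norm_hasDerivWithin_le (𝕜 := ℝ)
      (f := fun y : ℝ => (y:ℂ)^(-s)) (f' := fun y : ℝ => (-s) * (y:ℂ)^(-s-1))
      (s := Set.Icc X (X+1)) (C := ‖s‖ * X^(-s.re - 1)) (x := x) (y := X) ?_ ?_ (convex_Icc _ _)
      ⟨hx, hx1⟩ ⟨le_rfl, by linarith⟩
    · refine key.trans ?_
      have : ‖X - x‖ ≤ 1 := by rw [Real.norm_eq_abs, abs_le]; constructor <;> linarith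
      have h0 : 0 ≤ ‖s‖ * X^(-s.re - 1) := by positivity
      nlinarith
    · intro y hy
      have hy0 : y ≠ 0 := by have := hy.1; linarith
      have hs0 : -s ≠ 0 := by
        intro h; have : s.re = 0 := by rw [neg_eq_zero.mp h]; simp
        linarith
      exact (hasDerivAt_ofReal_cpow_const hy0 hs0).hasDerivWithinAt
    · intro y hy
      have hy0 : 0 < y := by have := hy.1; linarith
      rw [norm_mul, norm_neg, norm_cpow_eq_rpow_re_of_pos hy0]
      gcongr
      simp only [sub_re, neg_re, one_re]
      exact Real.rpow_le_rpow_of_nonpos hX0 hy.1 (by linarith)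
  have hD0 : 0 ≤ D := norm_nonneg _
  calc D = D^((59:ℝ)/60) * D^((1:ℝ)/60) := by
        rw [← Real.rpow_add_of_nonneg hD0 (by norm_num) (by norm_num)]; norm_num
    _ ≤ (2 * X^(-s.re))^((59:ℝ)/60) * (‖s‖ * X^(-s.re - 1))^((1:ℝ)/60) := by
        gcongr
    _ = (2:ℝ)^((59:ℝ)/60) * ‖s‖^((1:ℝ)/60) * (X^(-s.re * (59/60)) * X^((-s.re - 1)*(1/60))) := by
        rw [Real.mul_rpow (by norm_num) (by positivity), Real.mul_rpow (by positivity) (by positivity),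
          ← Real.rpow_mul hX0.le, ← Real.rpow_mul hX0.le]; ring
    _ = (2:ℝ)^((59:ℝ)/60) * ‖s‖^((1:ℝ)/60) * X^(-s.re - 1/60) := by
        rw [← Real.rpow_add hX0]; ring_nf
    _ ≤ 2 * ‖s‖^((1:ℝ)/60) * X^(-(121/120:ℝ)) := by
        gcongr
        · calc (2:ℝ)^((59:ℝ)/60) ≤ 2^(1:ℝ) := Real.rpow_le_rpow_of_exponent_le (by norm_num) (by norm_num)
            _ = 2 := by simp
        · linarith

noncomputable def hzc (b : ℝ) (n : ℕ) (s : ℂ) : ℂ :=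
  ((n + b : ℝ):ℂ)^(-s) - (((n + 1 + b : ℝ):ℂ)^(1-s) - ((n + b : ℝ):ℂ)^(1-s))/(1-s)

lemma hzc_bound {b : ℝ} (hb : 1 ≤ b) (n : ℕ) {s : ℂ} (hs : 119/120 < s.re) (hs1 : s ≠ 1) :
    ‖hzc b n s‖ ≤ 2 * ‖s‖^((1:ℝ)/60) * (n+b)^(-(121/120:ℝ)) := by
  have hX : (1:ℝ) ≤ n + b := by have : (0:ℝ) ≤ n := by positivity
                                linarith
  set X : ℝ := n + b with hXd
  have hIntg : ∫ x in X..(X+1), (x:ℂ)^(-s) =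
      (((n + 1 + b : ℝ):ℂ)^(1-s) - (X:ℂ)^(1-s))/(1-s) := by
    rw [integral_cpow]
    · have : X + 1 = n + 1 + b := by rw [hXd]; ring
      rw [this]; ring_nf
    · right
      refine ⟨?_, ?_⟩
      · intro h; apply hs1; rw [← neg_neg s, h]; simp
      · rw [Set.uIcc_of_le (by linarith)]
        intro h; linarith [h.1]
  have hcont : IntervalIntegrable (fun x : ℝ => (x:ℂ)^(-s)) MeasureTheory.volume X (X+1) := by
    apply intervalIntegral.intervalIntegrable_cpow
    right
    rw [Set.uIcc_of_le (by linarith)]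
    intro h; linarith [h.1]
  have : hzc b n s = ∫ x in X..(X+1), ((X:ℂ)^(-s) - (x:ℂ)^(-s)) := by
    rw [intervalIntegral.integral_sub (by simp) hcont, hIntg]
    simp [hzc, hXd]
  rw [this]
  have h := intervalIntegral.norm_integral_le_of_norm_le_const (a := X) (b := X+1)
    (f := fun x : ℝ => ((X:ℂ)^(-s) - (x:ℂ)^(-s))) (C := 2 * ‖s‖^((1:ℝ)/60) * X^(-(121/120:ℝ))) ?_
  · simpa using h
  · intro x hx
    rw [Set.uIoc_of_le (by linarith)] at hx
    exact rpow_diff_bound hX hx.1.le hx.2 hs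

lemma summable_shift {b : ℝ} (hb : 1 ≤ b) : Summable (fun n : ℕ => ((n:ℝ)+b)^(-(121/120:ℝ))) := by
  have h := (summable_nat_add_iff 1).mpr (Real.summable_nat_rpow.mpr (show (-(121/120:ℝ)) < -1 by norm_num))
  refine Summable.of_nonneg_of_le (fun n => by positivity) (fun n => ?_) h
  push_cast
  exact Real.rpow_le_rpow_of_nonpos (by positivity) (by linarith) (by norm_num)

lemma hz_eq_large {a : ℝ} (ha : a ∈ Set.Ioc (0:ℝ) 1) {s : ℂ} (hs : 1 < s.re) :
    HurwitzZeta.hurwitzZeta a s = (a:ℂ)^(-s) + ((a+1:ℝ):ℂ)^(1-s)/(s-1) + ∑' n, hzc (a+1) n s := by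
  have hs1 : s ≠ 1 := by rintro rfl; simp at hs
  have h1 := HurwitzZeta.hasSum_hurwitzZeta_of_one_lt_re ⟨ha.1.le, ha.2⟩ hs
  have h2 := (hasSum_nat_add_iff' 1).mpr h1
  have h3 : HasSum (fun n => hzc (a+1) n s) (∑' n, hzc (a+1) n s) := by
    apply Summable.hasSum
    apply Summable.of_norm_bounded ((summable_shift (b := a+1) (by linarith [ha.1])).mul_left (2 * ‖s‖^((1:ℝ)/60)))
    intro n
    exact hzc_bound (by linarith [ha.1]) n (by linarith) hs1
  have h4 := h2.sub h3
  have h5 : Tendsto (fun n : ℕ => (((n + (a+1) : ℝ):ℂ)^(1-s))/(1-s)) atTop (𝓝 0) := by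
    rw [← zero_div (1-s)]
    apply Tendsto.div_const
    rw [tendsto_zero_iff_norm_tendsto_zero]
    have : ∀ n : ℕ, ‖(((n + (a+1) : ℝ):ℂ)^(1-s))‖ = ((n:ℝ) + (a+1))^(-(s.re - 1)) := by
      intro n
      rw [norm_cpow_eq_rpow_re_of_pos (by have := ha.1; positivity)]; simp
    simp_rw [this]
    exact (tendsto_rpow_neg_atTop (by linarith)).comp
      (tendsto_atTop_add_const_right _ _ tendsto_natCast_atTop_atTop)
  have h6 : HasSum (fun n : ℕ => (((n + 1 + (a+1) : ℝ):ℂ)^(1-s) - ((n + (a+1) : ℝ):ℂ)^(1-s))/(1-s))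
      (0 - (((0:ℕ) + (a+1) : ℝ):ℂ)^(1-s)/(1-s)) := by
    have hsum : Summable (fun n : ℕ => (((n + 1 + (a+1) : ℝ):ℂ)^(1-s) - ((n + (a+1) : ℝ):ℂ)^(1-s))/(1-s)) := by
      refine h4.summable.congr ?_
      intro n
      simp only [hzc]
      rw [one_div, ← cpow_neg]
      push_cast
      ring_nf
    rw [hsum.hasSum_iff_tendsto_nat]
    have : ∀ N : ℕ, ∑ n ∈ Finset.range N, (((n + 1 + (a+1) : ℝ):ℂ)^(1-s) - ((n + (a+1) : ℝ):ℂ)^(1-s))/(1-s)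
        = (((N + (a+1) : ℝ):ℂ)^(1-s))/(1-s) - ((((0:ℕ) + (a+1) : ℝ):ℂ)^(1-s))/(1-s) := by
      intro N
      rw [← Finset.sum_range_sub (fun n : ℕ => (((n + (a+1) : ℝ):ℂ)^(1-s))/(1-s))]
      apply Finset.sum_congr rfl
      intro n _
      push_cast
      ring
    simp_rw [this]
    exact h5.sub_const _
  have h7 : HasSum (fun n : ℕ => (((n + 1 + (a+1) : ℝ):ℂ)^(1-s) - ((n + (a+1) : ℝ):ℂ)^(1-s))/(1-s))
      (HurwitzZeta.hurwitzZeta a s - ∑ i ∈ Finset.range 1, 1 / ((i:ℂ) + a)^s - ∑' n, hzc (a+1) n s) := by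
    have hfun : (fun n : ℕ => (((n + 1 + (a+1) : ℝ):ℂ)^(1-s) - ((n + (a+1) : ℝ):ℂ)^(1-s))/(1-s)) =
        fun n : ℕ => 1 / (((n + 1 : ℕ):ℂ) + a)^s - hzc (a+1) n s := by
      funext n
      simp only [hzc]
      rw [one_div, ← cpow_neg]
      push_cast
      ring_nf
    rw [hfun]
    exact h4
  have h8 := h6.unique h7
  simp at h8
  have hne : (1 - s) ≠ 0 := sub_ne_zero.mpr hs1.symm
  have hne' : (s - 1) ≠ 0 := sub_ne_zero.mpr hs1
  have : ((a+1:ℝ):ℂ)^(1-s)/(s-1) = -(((a:ℂ)+1)^(1-s)/(1-s)) := by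
    rw [← neg_sub s 1, div_neg, neg_neg]; push_cast; rfl
  rw [this, h8, cpow_neg]; ring

lemma differentiableOn_hzc {b : ℝ} (hb : 1 ≤ b) (n : ℕ) {U : Set ℂ} (hU : ∀ s ∈ U, s ≠ 1) :
    DifferentiableOn ℂ (hzc b n) U := by
  intro s hs
  have h1 : 1 - s ≠ 0 := sub_ne_zero.mpr (hU s hs).symm
  have h2 : ((n + b : ℝ):ℂ) ≠ 0 := by
    have : (0:ℝ) < n + b := by positivity
    exact_mod_cast this.ne'
  have h3 : ((n + 1 + b : ℝ):ℂ) ≠ 0 := by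
    have : (0:ℝ) < n + 1 + b := by positivity
    exact_mod_cast this.ne'
  unfold hzc
  apply DifferentiableAt.differentiableWithinAt
  refine DifferentiableAt.sub ?_ (DifferentiableAt.div (DifferentiableAt.sub ?_ ?_) ?_ h1)
  · exact DifferentiableAt.const_cpow (by fun_prop) (Or.inl h2)
  · exact DifferentiableAt.const_cpow (by fun_prop) (Or.inl h3)
  · exact DifferentiableAt.const_cpow (by fun_prop) (Or.inl h2)
  · fun_prop

lemma hz_eq {a : ℝ} (ha : a ∈ Set.Ioc (0:ℝ) 1) {s : ℂ} (hs : 119/120 < s.re) (him : 1 ≤ |s.im|) :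
    HurwitzZeta.hurwitzZeta a s = (a:ℂ)^(-s) + ((a+1:ℝ):ℂ)^(1-s)/(s-1) + ∑' n, hzc (a+1) n s := by
  obtain ⟨e, he, hes⟩ : ∃ e : ℝ, (e = 1 ∨ e = -1) ∧ 1 ≤ e * s.im := by
    rcases le_abs.mp him with h | h
    · exact ⟨1, Or.inl rfl, by linarith⟩
    · exact ⟨-1, Or.inr rfl, by linarith⟩
  set R : ℝ := ‖s‖ + 10 with hR
  set U : Set ℂ := ({z : ℂ | 119/120 < z.re} ∩ {z : ℂ | 1/2 < e * z.im}) ∩ Metric.ball 0 R with hU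
  have hUo : IsOpen U := by
    refine IsOpen.inter (IsOpen.inter ?_ ?_) Metric.isOpen_ball
    · exact isOpen_lt continuous_const continuous_re
    · exact isOpen_lt continuous_const (continuous_const.mul continuous_im)
  have hUc : Convex ℝ U := by
    refine Convex.inter (Convex.inter ?_ ?_) (convex_ball _ _)
    · exact convex_halfSpace_re_gt _
    · have := convex_halfSpace_gt (f := fun z : ℂ => e * z.im)
        ⟨fun x y => by
          change e * (x + y).im = e * x.im + e * y.im
          rw [add_im]; ring, fun c x => by
          change e * (c • x).im = c * (e * x.im)
          rw [smul_im, smul_eq_mul]; ring⟩ (1/2)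
      exact this
  have hU1 : ∀ z ∈ U, z ≠ 1 := by
    rintro z hz rfl
    have := hz.1.2
    simp at this
    norm_num at this
  have hdz : DifferentiableOn ℂ (fun z => HurwitzZeta.hurwitzZeta a z) U := fun z hz =>
    (HurwitzZeta.differentiableAt_hurwitzZeta _ (hU1 z hz)).differentiableWithinAt
  have hds : DifferentiableOn ℂ (fun z => ∑' n, hzc (a+1) n z) U := by
    apply differentiableOn_tsum_of_summable_norm
      ((summable_shift (b := a+1) (by linarith [ha.1])).mul_left (2 * R^((1:ℝ)/60)))
    · intro n
      exact differentiableOn_hzc (by linarith [ha.1]) n hU1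
    · exact hUo
    · intro n w hw
      refine (hzc_bound (by linarith [ha.1]) n hw.1.1 (hU1 w hw)).trans ?_
      have hb : 0 ≤ (n:ℝ) + (a+1) := by have := ha.1; positivity
      have : ‖w‖ ≤ R := by have := hw.2; simp at this; exact this.le
      gcongr
  have hda : DifferentiableOn ℂ (fun z : ℂ => (a:ℂ)^(-z) + ((a+1:ℝ):ℂ)^(1-z)/(z-1) + ∑' n, hzc (a+1) n z) U := by
    refine DifferentiableOn.add ?_ hds
    intro z hz
    apply DifferentiableAt.differentiableWithinAt
    have h0 : (a:ℂ) ≠ 0 := by exact_mod_cast ha.1.ne'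
    have h1 : ((a+1:ℝ):ℂ) ≠ 0 := by
      have : (0:ℝ) < a + 1 := by linarith [ha.1]
      exact_mod_cast this.ne'
    refine DifferentiableAt.add (DifferentiableAt.const_cpow (by fun_prop) (Or.inl h0))
      (DifferentiableAt.div (DifferentiableAt.const_cpow (by fun_prop) (Or.inl h1)) (by fun_prop)
        (sub_ne_zero.mpr (hU1 z hz)))
  set z0 : ℂ := ⟨2, 2*e⟩ with hz0
  have hee : e * e = 1 := by rcases he with h | h <;> rw [h] <;> norm_num
  have hz0U : z0 ∈ U := by
    refine ⟨⟨?_, ?_⟩, ?_⟩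
    · simp [hz0]; norm_num
    · simp only [hz0, Set.mem_ofPred_eq]; nlinarith
    · simp only [Metric.mem_ball, dist_zero_right]
      have : ‖z0‖ ≤ |z0.re| + |z0.im| := norm_le_abs_re_add_abs_im z0
      have h2 : |e| = 1 := by rcases he with h | h <;> rw [h] <;> norm_num
      simp only [hz0, abs_mul, h2] at this
      norm_num at this
      have := norm_nonneg s
      linarith
  have hEq := (hdz.analyticOnNhd hUo).eqOn_of_preconnected_of_eventuallyEq (hda.analyticOnNhd hUo)
    hUc.isPreconnected hz0U ?_
  · exact hEq ⟨⟨hs, by simp only [Set.mem_ofPred_eq]; linarith⟩, by simp [hR]⟩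
  · have : {z : ℂ | 1 < z.re} ∈ 𝓝 z0 := (isOpen_lt continuous_const continuous_re).mem_nhds (by simp [hz0])
    filter_upwards [this] with z hz
    exact hz_eq_large ha hz

lemma hz_bound {a : ℝ} (ha : a ∈ Set.Ioc (0:ℝ) 1) : ∃ C : ℝ, 0 ≤ C ∧ ∀ s : ℂ, 119/120 < s.re →
    s.re ≤ 4 → 1 ≤ |s.im| → ‖HurwitzZeta.hurwitzZeta a s‖ ≤ C * |s.im|^((1:ℝ)/60) := by
  set S := ∑' n : ℕ, ((n:ℝ)+(a+1))^(-(121/120:ℝ)) with hS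
  have hS0 : 0 ≤ S := tsum_nonneg fun n => by have := ha.1; positivity
  refine ⟨a^(-4:ℝ) + 2 + 10 * S, by have := ha.1; positivity, fun s hs hs4 him => ?_⟩
  have hs1 : s ≠ 1 := by
    rintro rfl
    simp at him
    norm_num at him
  have hp : (1:ℝ) ≤ |s.im|^((1:ℝ)/60) := Real.one_le_rpow him (by norm_num)
  rw [hz_eq ha hs him]
  have hsum := summable_shift (b := a+1) (by linarith [ha.1])
  have h1 : ‖(a:ℂ)^(-s)‖ ≤ a^(-4:ℝ) := by
    rw [norm_cpow_eq_rpow_re_of_pos ha.1]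
    exact Real.rpow_le_rpow_of_exponent_ge ha.1 ha.2 (by simpa using hs4)
  have h2 : ‖((a+1:ℝ):ℂ)^(1-s)/(s-1)‖ ≤ 2 := by
    rw [norm_div, norm_cpow_eq_rpow_re_of_pos (by linarith [ha.1])]
    have hd : 1 ≤ ‖s - 1‖ := by
      refine him.trans ?_
      have := abs_im_le_norm (s-1)
      simpa using this
    rw [div_le_iff₀ (by linarith)]
    calc (a+1)^((1-s).re) ≤ (2:ℝ)^(1:ℝ) := by
          calc (a+1)^((1-s).re) ≤ (a+1)^(1:ℝ) := by
                apply Real.rpow_le_rpow_of_exponent_le (by linarith [ha.1])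
                simp; linarith
            _ ≤ 2^(1:ℝ) := by
                apply Real.rpow_le_rpow (by linarith [ha.1]) (by linarith [ha.2]) (by norm_num)
      _ = 2 := by simp
      _ ≤ 2 * ‖s-1‖ := by linarith
  have h3 : ‖∑' n, hzc (a+1) n s‖ ≤ 2 * ‖s‖^((1:ℝ)/60) * S := by
    rw [hS, ← tsum_mul_left]
    exact tsum_of_norm_bounded (hsum.mul_left _).hasSum
      (fun n => hzc_bound (by linarith [ha.1]) n hs hs1)
  have h4 : ‖s‖^((1:ℝ)/60) ≤ 5 * |s.im|^((1:ℝ)/60) := by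
    have : ‖s‖ ≤ 5 * |s.im| := by
      have := norm_le_abs_re_add_abs_im s
      have h5 : |s.re| ≤ 4 := by rw [abs_le]; constructor <;> linarith
      linarith
    calc ‖s‖^((1:ℝ)/60) ≤ (5 * |s.im|)^((1:ℝ)/60) := by gcongr
      _ = 5^((1:ℝ)/60) * |s.im|^((1:ℝ)/60) := Real.mul_rpow (by norm_num) (by positivity)
      _ ≤ 5 * |s.im|^((1:ℝ)/60) := by
        gcongr
        calc (5:ℝ)^((1:ℝ)/60) ≤ 5^(1:ℝ) := Real.rpow_le_rpow_of_exponent_le (by norm_num) (by norm_num)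
          _ = 5 := by simp
  have ha4 : 0 ≤ a^(-4:ℝ) := by have := ha.1; positivity
  calc _ ≤ a^(-4:ℝ) + 2 + 2 * ‖s‖^((1:ℝ)/60) * S := by
        refine (norm_add_le _ _).trans (add_le_add ((norm_add_le _ _).trans (add_le_add h1 h2)) h3)
    _ ≤ a^(-4:ℝ) * |s.im|^((1:ℝ)/60) + 2 * |s.im|^((1:ℝ)/60) + 2 * (5 * |s.im|^((1:ℝ)/60)) * S := by
        gcongr
        · exact le_mul_of_one_le_right ha4 hp
        · linarith
    _ = _ := by ring

/-- Upper bound for Dirichlet L-functions mod 8 slightly to the left of the line Re s = 1. -/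
lemma L_upper : ∃ C : ℝ, 0 < C ∧ ∀ χ : DirichletCharacter ℂ 8, ∀ s : ℂ, 119/120 < s.re →
    s.re ≤ 4 → 1 ≤ |s.im| → ‖DirichletCharacter.LFunction χ s‖ ≤ C * |s.im|^((1:ℝ)/60) := by
  have hj : ∀ j : ZMod 8, ∃ C : ℝ, 0 ≤ C ∧ ∀ χ : DirichletCharacter ℂ 8, ∀ s : ℂ, 119/120 < s.re →
    s.re ≤ 4 → 1 ≤ |s.im| → ‖χ j * HurwitzZeta.hurwitzZeta (ZMod.toAddCircle j) s‖ ≤ C * |s.im|^((1:ℝ)/60) := by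
    intro j
    by_cases h0 : j = 0
    · subst h0
      refine ⟨0, le_rfl, fun χ s _ _ _ => ?_⟩
      have : χ 0 = 0 := MulChar.map_nonunit χ (by decide)
      simp [this]
    · have hmem : ((j.val:ℝ) / (8:ℕ)) ∈ Set.Ioc (0:ℝ) 1 := by
        constructor
        · have : 0 < j.val := Nat.pos_of_ne_zero (by simpa [ZMod.val_eq_zero] using h0)
          positivity
        · rw [div_le_one (by norm_num)]
          exact_mod_cast (ZMod.val_lt j).le
      obtain ⟨C, hC0, hC⟩ := hz_bound hmem
      refine ⟨C, hC0, fun χ s h1 h2 h3 => ?_⟩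
      rw [norm_mul, ZMod.toAddCircle_apply]
      have := hC s h1 h2 h3
      have hχ := DirichletCharacter.norm_le_one χ j
      calc _ ≤ 1 * ‖HurwitzZeta.hurwitzZeta (((j.val:ℝ) / (8:ℕ) : ℝ) : UnitAddCircle) s‖ := by gcongr
        _ ≤ _ := by rw [one_mul]; exact this
  choose C hC0 hC using hj
  refine ⟨∑ j, C j + 1, by have := Finset.sum_nonneg (fun j (_ : j ∈ Finset.univ) => hC0 j); linarith, fun χ s h1 h2 h3 => ?_⟩
  have h8 : ‖((8:ℕ):ℂ)^(-s)‖ ≤ 1 := by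
    rw [norm_natCast_cpow_of_pos (by norm_num)]
    exact Real.rpow_le_one_of_one_le_of_nonpos (by norm_num) (by simp; linarith)
  rw [DirichletCharacter.LFunction, ZMod.LFunction, norm_mul]
  calc _ ≤ 1 * ∑ j, C j * |s.im|^((1:ℝ)/60) := by
        gcongr
        exact (norm_sum_le _ _).trans (Finset.sum_le_sum fun j _ => hC j χ s h1 h2 h3)
    _ ≤ _ := by
        rw [one_mul, ← Finset.sum_mul]
        gcongr
        linarith

end PartA1

section PartA2

open Complex Filter Topology

noncomputable def rhoT (t : ℝ) : ℝ := |t|^((1:ℝ)/240)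

lemma one_le_rhoT {t : ℝ} (ht : 1 ≤ |t|) : 1 ≤ rhoT t := Real.one_le_rpow ht (by norm_num)

lemma rhoT_pow_four (t : ℝ) : rhoT t ^ 4 = |t|^((1:ℝ)/60) := by
  rw [rhoT, ← Real.rpow_natCast, ← Real.rpow_mul (abs_nonneg _)]; norm_num

lemma rhoT_pow_twenty (t : ℝ) : rhoT t ^ 20 = |t|^((1:ℝ)/12) := by
  rw [rhoT, ← Real.rpow_natCast, ← Real.rpow_mul (abs_nonneg _)]; norm_num

lemma two_rpow_le {t u : ℝ} (h : |u| ≤ 2 * |t|) {p : ℝ} (hp : 0 ≤ p) (hp1 : p ≤ 1) :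
    |u|^p ≤ 2 * |t|^p := by
  calc |u|^p ≤ (2*|t|)^p := by gcongr
    _ = 2^p * |t|^p := Real.mul_rpow (by norm_num) (abs_nonneg _)
    _ ≤ 2 * |t|^p := by
      gcongr
      calc (2:ℝ)^p ≤ 2^(1:ℝ) := Real.rpow_le_rpow_of_exponent_le (by norm_num) hp1
        _ = 2 := by simp

lemma im_ne_one_of {s : ℂ} (h : 1 ≤ |s.im|) : s ≠ 1 := by
  rintro rfl
  simp at h
  norm_num at h

lemma L_deriv_upper : ∃ C : ℝ, 0 < C ∧ ∀ χ : DirichletCharacter ℂ 8, ∀ s : ℂ, 239/240 ≤ s.re →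
    s.re ≤ 3 → 2 ≤ |s.im| → ‖deriv (DirichletCharacter.LFunction χ) s‖ ≤ C * rhoT s.im ^ 4 := by
  obtain ⟨C, hC0, hC⟩ := L_upper
  refine ⟨C * 2 * 480, by positivity, fun χ s h1 h2 h3 => ?_⟩
  have key := Complex.norm_deriv_le_of_forall_mem_sphere_norm_le
    (f := DirichletCharacter.LFunction χ) (c := s) (R := 1/480)
    (C := C * (2 * |s.im|^((1:ℝ)/60))) (by norm_num) ?_ ?_
  · refine key.trans (le_of_eq ?_)
    rw [rhoT_pow_four]; ring
  · have hU : ∀ z ∈ Metric.ball s (1/480:ℝ) ∪ Metric.closedBall s (1/480:ℝ), z ≠ 1 := by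
      rintro z hz rfl
      have hz' : ‖1 - s‖ ≤ 1/480 := by
        rcases hz with hz | hz
        · simp only [Metric.mem_ball, dist_eq_norm] at hz; exact hz.le
        · simpa only [Metric.mem_closedBall, dist_eq_norm] using hz
      have := abs_im_le_norm (1 - s)
      simp at this
      linarith
    apply DifferentiableOn.diffContOnCl_ball (U := Metric.closedBall s (1/480:ℝ)) ?_ subset_rfl
    intro z hz
    exact (DirichletCharacter.differentiableAt_LFunction χ z (Or.inl (hU z (Or.inr hz)))).differentiableWithinAt
  · intro z hz
    have hz' : ‖z - s‖ = 1/480 := by simpa only [Metric.mem_sphere, dist_eq_norm] using hz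
    have hre := abs_re_le_norm (z - s)
    have him := abs_im_le_norm (z - s)
    rw [hz'] at hre him
    simp only [sub_re, sub_im] at hre him
    rw [abs_le] at hre
    have ha := abs_sub_abs_le_abs_sub s.im z.im
    have hb := abs_sub_abs_le_abs_sub z.im s.im
    rw [abs_sub_comm] at ha
    refine (hC χ z (by linarith) (by linarith) (by linarith)).trans ?_
    gcongr
    exact two_rpow_le (by linarith) (by norm_num) (by norm_num)

lemma triv_upper : ∃ C : ℝ, 0 < C ∧ ∀ x : ℝ, 0 < x → x ≤ 2 →
    ‖DirichletCharacter.LFunctionTrivChar 8 (1 + x)‖ * x ≤ C := by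
  have hc : ContinuousOn (fun x : ℝ => DirichletCharacter.LFunctionTrivChar₁ 8 (1 + x)) (Set.Icc 0 2) := by
    have := (DirichletCharacter.differentiable_LFunctionTrivChar₁ 8).continuous
    exact (this.comp (by fun_prop : Continuous fun x : ℝ => (1 + x : ℂ))).continuousOn
  obtain ⟨C, hC⟩ := isCompact_Icc.exists_bound_of_continuousOn hc
  refine ⟨|C| + 1, by positivity, fun x hx hx2 => ?_⟩
  have := hC x ⟨hx.le, hx2⟩
  have hne : (1 + x : ℂ) ≠ 1 := by
    intro h
    have : (x:ℂ) = 0 := by simpa using h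
    exact hx.ne' (by exact_mod_cast this)
  rw [DirichletCharacter.LFunctionTrivChar₁, Function.update_of_ne hne, norm_mul] at this
  simp only [add_sub_cancel_left, norm_real, Real.norm_eq_abs, abs_of_pos hx] at this
  have h2 := le_abs_self C
  linarith

lemma L_lower_right : ∃ c : ℝ, 0 < c ∧ ∀ χ : DirichletCharacter ℂ 8, ∀ s : ℂ, 1 < s.re →
    s.re ≤ 3 → 2 ≤ |s.im| → c * (s.re - 1)^3 ≤ ‖DirichletCharacter.LFunction χ s‖^4 * rhoT s.im ^ 4 := by
  obtain ⟨C, hC0, hC⟩ := L_upper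
  obtain ⟨D, hD0, hD⟩ := triv_upper
  refine ⟨(D^3 * (C*2))⁻¹, by positivity, fun χ s h1 h2 h3 => ?_⟩
  set x := s.re - 1 with hx
  have hx0 : 0 < x := by rw [hx]; linarith
  have key := DirichletCharacter.norm_LFunction_product_ge_one χ hx0 s.im
  have hs : (1 + x + I * s.im : ℂ) = s := by
    apply Complex.ext <;> simp [hx]
  have h2s := hC (χ^2) (1 + x + 2 * I * s.im) (by simp [hx]; linarith) (by simp [hx]; linarith)
    (by simp [abs_mul]; linarith)
  have him : (1 + x + 2 * I * s.im : ℂ).im = 2 * s.im := by simp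
  rw [him] at h2s
  have h2s' : ‖DirichletCharacter.LFunction (χ^2) (1 + x + 2 * I * s.im)‖ ≤ C * (2 * rhoT s.im ^ 4) := by
    refine h2s.trans ?_
    rw [rhoT_pow_four]
    gcongr
    exact two_rpow_le (by simp [abs_mul]) (by norm_num) (by norm_num)
  rw [hs, norm_mul, norm_mul, norm_pow, norm_pow] at key
  have hT := hD x hx0 (by linarith)
  have hT3 : ‖DirichletCharacter.LFunctionTrivChar 8 (1 + x)‖^3 * x^3 ≤ D^3 := by
    rw [← mul_pow]; gcongr
  rw [inv_mul_le_iff₀ (by positivity)]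
  set A := ‖DirichletCharacter.LFunctionTrivChar 8 (1 + x)‖
  set B := ‖DirichletCharacter.LFunction χ s‖
  set E := ‖DirichletCharacter.LFunction (χ^2) (1 + x + 2 * I * s.im)‖
  calc x^3 ≤ x^3 * (A^3 * B^4 * E) := le_mul_of_one_le_right (by positivity) key
    _ = (A^3 * x^3) * B^4 * E := by ring
    _ ≤ D^3 * B^4 * (C * (2 * rhoT s.im^4)) := by gcongr
    _ = _ := by ring

/-- Quantitative zero-free region and bound for the logarithmic derivative. -/
lemma L_region : ∃ c B : ℝ, 0 < c ∧ c ≤ 1/240 ∧ 0 < B ∧ ∀ χ : DirichletCharacter ℂ 8, ∀ s : ℂ,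
    2 ≤ |s.im| → 1 - c / rhoT s.im ^ 20 ≤ s.re → s.re ≤ 3 →
    DirichletCharacter.LFunction χ s ≠ 0 ∧
    ‖deriv (DirichletCharacter.LFunction χ) s / DirichletCharacter.LFunction χ s‖ ≤ B * rhoT s.im ^ 20 := by
  obtain ⟨C, hC0, hC⟩ := L_deriv_upper
  obtain ⟨d4, hd40, hd⟩ := L_lower_right
  obtain ⟨d, hd0, hdd⟩ : ∃ d : ℝ, 0 < d ∧ d^4 ≤ d4 := by
    refine ⟨d4^((1:ℝ)/4), by positivity, ?_⟩
    rw [← Real.rpow_natCast, ← Real.rpow_mul hd40.le]; norm_num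
  set c1 := min (d/(4*C)) (1/240) with hc1
  have hc10 : 0 < c1 := by rw [hc1]; positivity
  have hc1a : 4 * C * c1 ≤ d := by
    have : c1 ≤ d/(4*C) := min_le_left _ _
    rw [le_div_iff₀ (by positivity)] at this; linarith
  have hc1b : c1 ≤ 1/240 := min_le_right _ _
  have hc14 : c1^4 ≤ 1/240 := by
    calc c1^4 ≤ (1/240)^4 := by gcongr
      _ ≤ _ := by norm_num
  refine ⟨c1^4, 2*C/(d*c1^3), by positivity, hc14, by positivity, fun χ s h1 h2 h3 => ?_⟩
  set r := rhoT s.im with hr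
  have hr1 : 1 ≤ r := one_le_rhoT (by linarith)
  have hr0 : 0 < r := by linarith
  set y := c1 / r^5 with hy
  have hy0 : 0 < y := by positivity
  have hy4 : y^4 = c1^4 / r^20 := by rw [hy, div_pow]; ring
  have hy4s : y^4 ≤ 1/240 := by
    rw [hy4]
    exact (div_le_self (by positivity) (one_le_pow₀ hr1)).trans hc14
  rw [← hy4] at h2
  have hfar : ∀ z : ℂ, z.im = s.im → 1 + y^4 ≤ z.re → z.re ≤ 3 →
      d * y^3 / r ≤ ‖DirichletCharacter.LFunction χ z‖ := by
    intro z hz hz1 hz3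
    have hh := hd χ z (by have : 0 < y^4 := by positivity
                          linarith) hz3 (by rw [hz]; exact h1)
    rw [hz, ← hr, ← mul_pow] at hh
    rw [div_le_iff₀ hr0]
    apply le_of_pow_le_pow_left₀ (n := 4) (by norm_num) (by positivity)
    refine le_trans ?_ hh
    calc (d*y^3)^4 = d^4 * (y^4)^3 := by ring
      _ ≤ d4 * (z.re - 1)^3 := by
        gcongr
        linarith
  have hlow : d * y^3 / (2*r) ≤ ‖DirichletCharacter.LFunction χ s‖ := by
    by_cases hcase : 1 + y^4 ≤ s.re
    · refine le_trans ?_ (hfar s rfl hcase h3)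
      gcongr
      linarith
    · push Not at hcase
      set z : ℂ := ⟨1 + y^4, s.im⟩ with hz
      have hzf := hfar z rfl le_rfl (by simp only [hz]; linarith)
      have hseg := Convex.norm_image_sub_le_of_norm_deriv_le (𝕜 := ℂ)
        (f := DirichletCharacter.LFunction χ) (s := {w : ℂ | w.im = s.im} ∩ {w : ℂ | 239/240 ≤ w.re} ∩ {w : ℂ | w.re ≤ 3})
        (C := C * r^4) (x := s) (y := z) ?_ ?_ ?_ ?_ ?_
      · have hn : ‖z - s‖ ≤ 2 * y^4 := by
          have := norm_le_abs_re_add_abs_im (z - s)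
          simp only [hz, sub_re, sub_im, sub_self, abs_zero, add_zero] at this
          refine this.trans ?_
          rw [abs_le]; constructor <;> linarith
        have h5 : ‖DirichletCharacter.LFunction χ z‖ ≤ ‖DirichletCharacter.LFunction χ s‖ + C * r^4 * (2*y^4) := by
          have h6 := norm_sub_norm_le (DirichletCharacter.LFunction χ z) (DirichletCharacter.LFunction χ s)
          have h7 : C * r^4 * ‖z-s‖ ≤ C * r^4 * (2*y^4) := by gcongr
          linarith
        have h8 : C * r^4 * (2*y^4) ≤ d * y^3 / (2*r) := by
          rw [le_div_iff₀ (by positivity)]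
          have : r^5 * y = c1 := by rw [hy]; field_simp
          calc C * r^4 * (2*y^4) * (2*r) = 4 * C * (r^5 * y) * y^3 := by ring
            _ = (4 * C * c1) * y^3 := by rw [this]
            _ ≤ d * y^3 := by gcongr
        have h9 : d * y^3 / r = d * y^3 / (2*r) + d * y^3 / (2*r) := by field_simp; ring
        linarith
      · rintro w ⟨⟨hw1, hw2⟩, hw3⟩
        apply DirichletCharacter.differentiableAt_LFunction χ w (Or.inl (im_ne_one_of ?_))
        rw [hw1]; linarith
      · rintro w ⟨⟨hw1, hw2⟩, hw3⟩
        have := hC χ w hw2 hw3 (by rw [hw1]; exact h1)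
        rwa [hw1] at this
      · refine Convex.inter (Convex.inter ?_ ?_) ?_
        · exact convex_hyperplane (f := im) ⟨add_im, fun c x => by simp⟩ s.im
        · exact convex_halfSpace_re_ge _
        · exact convex_halfSpace_re_le _
      · refine ⟨⟨rfl, ?_⟩, h3⟩
        change 239/240 ≤ s.re
        linarith
      · refine ⟨⟨rfl, ?_⟩, ?_⟩
        · change 239/240 ≤ 1 + y^4
          have : 0 < y^4 := by positivity
          linarith
        · change 1 + y^4 ≤ 3
          linarith
  have hpos : 0 < d * y^3 / (2*r) := by positivity
  have hLpos : 0 < ‖DirichletCharacter.LFunction χ s‖ := lt_of_lt_of_le hpos hlow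
  refine ⟨norm_pos_iff.mp hLpos, ?_⟩
  rw [norm_div]
  calc _ ≤ (C * r^4) / (d * y^3 / (2*r)) := by
        gcongr
        exact hC χ s (by linarith) h3 h1
    _ = _ := by rw [hy]; field_simp

end PartA2

section PartA3

open Complex Filter Topology
open ArithmeticFunction ArithmeticFunction.vonMangoldt DirichletCharacter

noncomputable def Haux (a : ZMod 8) (s : ℂ) : ℂ := (LFunctionResidueClassAux a s - (4:ℂ)⁻¹) / s

lemma Haux_analyticAt (a : ZMod 8) {s : ℂ} (hs0 : s ≠ 0)
    (h : ∀ χ : DirichletCharacter ℂ 8, (χ ≠ 1 ∨ s ≠ 1) → LFunction χ s ≠ 0) :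
    AnalyticAt ℂ (Haux a) s := by
  have hT : AnalyticAt ℂ (LFunctionTrivChar₁ 8) s :=
    (differentiable_LFunctionTrivChar₁ 8).analyticAt s
  have hT0 : LFunctionTrivChar₁ 8 s ≠ 0 := by
    rcases eq_or_ne s 1 with rfl | h1
    · exact LFunctionTrivChar₁_apply_one_ne_zero 8
    · rw [LFunctionTrivChar₁, Function.update_of_ne h1]
      exact mul_ne_zero (sub_ne_zero.mpr h1) (h 1 (Or.inr h1))
  unfold Haux
  refine AnalyticAt.div (AnalyticAt.sub ?_ analyticAt_const) analyticAt_id hs0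
  unfold LFunctionResidueClassAux
  refine analyticAt_const.mul (AnalyticAt.sub (hT.deriv.neg.div hT hT0) ?_)
  refine Finset.analyticAt_fun_sum _ fun χ hχ => ?_
  have hχ1 : χ ≠ 1 := by simpa using hχ
  have hL : AnalyticAt ℂ (LFunction χ) s := (differentiable_LFunction hχ1).analyticAt s
  exact (analyticAt_const.mul hL.deriv).div hL (h χ (Or.inl hχ1))

lemma Haux_analyticAt' (a : ZMod 8) {s : ℂ} (hs : 1 ≤ s.re) : AnalyticAt ℂ (Haux a) s := by
  refine Haux_analyticAt a ?_ fun χ h => LFunction_ne_zero_of_one_le_re χ h hs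
  rintro rfl
  norm_num at hs

lemma Haux_bound (a : ZMod 8) : ∃ c B : ℝ, 0 < c ∧ c ≤ 1/240 ∧ 0 < B ∧ ∀ s : ℂ,
    2 ≤ |s.im| → 1 - c / rhoT s.im ^ 20 ≤ s.re → s.re ≤ 3 →
    AnalyticAt ℂ (Haux a) s ∧ ‖Haux a s‖ ≤ B * rhoT s.im ^ 20 / |s.im| := by
  obtain ⟨c, B, hc, hc1, hB, h⟩ := L_region
  set N : ℝ := ((({1}ᶜ : Finset (DirichletCharacter ℂ 8)).card : ℕ) : ℝ) with hN
  refine ⟨c, 2 + B + N * B, hc, hc1, by positivity, fun s h1 h2 h3 => ?_⟩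
  have hne : s ≠ 1 := im_ne_one_of (by linarith)
  have him : 0 < |s.im| := by linarith
  have hs0 : s ≠ 0 := by rintro rfl; norm_num at h1
  refine ⟨Haux_analyticAt a hs0 fun χ _ => (h χ s h1 h2 h3).1, ?_⟩
  have hR : 1 ≤ rhoT s.im ^ 20 := one_le_pow₀ (one_le_rhoT (by linarith))
  set R := rhoT s.im ^ 20
  unfold Haux
  rw [norm_div]
  refine div_le_div₀ (by positivity) ?_ him (Complex.abs_im_le_norm s)
  have e1 : ‖-deriv (LFunctionTrivChar₁ 8) s / LFunctionTrivChar₁ 8 s‖ ≤ 1 + B * R := by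
    rw [deriv_LFunctionTrivChar₁_apply_of_ne_one _ hne, LFunctionTrivChar₁,
      Function.update_of_ne hne, LFunctionTrivChar, neg_div, norm_neg, add_div,
      mul_div_mul_left _ _ (sub_ne_zero_of_ne hne)]
    have := (h 1 s h1 h2 h3).1
    rw [add_comm]
    have e : LFunction (1 : DirichletCharacter ℂ 8) s / ((s - 1) * LFunction (1 : DirichletCharacter ℂ 8) s) = 1 / (s-1) := by
      field_simp [sub_ne_zero_of_ne hne]
    rw [e]
    refine (norm_add_le _ _).trans (add_le_add ?_ (h 1 s h1 h2 h3).2)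
    rw [norm_div, norm_one]
    have h4 := Complex.abs_im_le_norm (s-1)
    simp at h4
    rw [div_le_one (by linarith)]; linarith
  have e2 : ‖∑ χ ∈ ({1}ᶜ : Finset (DirichletCharacter ℂ 8)), χ a⁻¹ * deriv (LFunction χ) s / LFunction χ s‖ ≤ N * (B*R) := by
    refine (norm_sum_le _ _).trans ?_
    rw [hN, ← nsmul_eq_mul]
    refine Finset.sum_le_card_nsmul _ _ _ fun χ _ => ?_
    rw [mul_div_assoc, norm_mul]
    calc _ ≤ 1 * (B*R) := mul_le_mul (χ.norm_le_one _) (h χ s h1 h2 h3).2 (norm_nonneg _) (by norm_num)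
      _ = _ := one_mul _
  have ht : Nat.totient 8 = 4 := by decide
  have e3 : ‖LFunctionResidueClassAux a s‖ ≤ 1 + B * R + N * (B*R) := by
    unfold LFunctionResidueClassAux
    rw [norm_mul, ht]
    have : ‖((4:ℕ):ℂ)⁻¹‖ ≤ 1 := by rw [norm_inv, Complex.norm_natCast]; norm_num
    calc _ ≤ 1 * (1 + B * R + N * (B*R)) := by
          refine mul_le_mul this ((norm_sub_le _ _).trans (add_le_add e1 ?_)) (norm_nonneg _) (by norm_num)
          refine le_trans (le_of_eq ?_) e2
          congr!
      _ = _ := one_mul _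
  have e4 : ‖(4:ℂ)⁻¹‖ ≤ 1 := by rw [norm_inv]; norm_num
  calc _ ≤ 1 + B * R + N * (B*R) + 1 := (norm_sub_le _ _).trans (add_le_add e3 e4)
    _ ≤ _ := by nlinarith

lemma iteratedDeriv_two_eq (f : ℂ → ℂ) : iteratedDeriv 2 f = deriv (deriv f) := by
  rw [iteratedDeriv_succ, iteratedDeriv_one]

lemma Haux_dd_bound (a : ZMod 8) : ∃ C : ℝ, 0 < C ∧ ∀ s : ℂ, 1 ≤ s.re → s.re ≤ 2 →
    ‖iteratedDeriv 2 (Haux a) s‖ ≤ C * (1 + |s.im|)^(-(3/4):ℝ) := by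
  obtain ⟨c, B, hc, hc1, hB, h⟩ := Haux_bound a
  -- compact part
  have hK : IsCompact (Set.Icc (1:ℝ) 2 ×ℂ Set.Icc (-4:ℝ) 4) := isCompact_Icc.reProdIm isCompact_Icc
  have hcont : ContinuousOn (iteratedDeriv 2 (Haux a)) (Set.Icc (1:ℝ) 2 ×ℂ Set.Icc (-4:ℝ) 4) := by
    intro s hs
    rw [iteratedDeriv_two_eq]
    exact (Haux_analyticAt' a (Complex.mem_reProdIm.mp hs).1.1).deriv.deriv.continuousAt.continuousWithinAt
  obtain ⟨M, hM⟩ := hK.exists_bound_of_continuousOn hcont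
  set K : ℝ := 2 * (4 * B) * (4 / c^2) with hKdef
  have hKpos : 0 < K := by positivity
  refine ⟨(|M|+1) * 5 + 2 * K, by positivity, fun s h1 h2 => ?_⟩
  rcases le_total |s.im| 4 with h4 | h4
  · have hb := hM s (Complex.mem_reProdIm.mpr ⟨⟨h1, h2⟩, abs_le.mp h4⟩)
    have h5 : (5:ℝ)⁻¹ ≤ (1 + |s.im|)^(-(3/4):ℝ) := by
      rw [Real.rpow_neg (by positivity)]
      refine inv_anti₀ (by positivity) ?_
      calc (1+|s.im|)^(3/4:ℝ) ≤ 5^(3/4:ℝ) := by gcongr; linarith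
        _ ≤ 5^(1:ℝ) := Real.rpow_le_rpow_of_exponent_le (by norm_num) (by norm_num)
        _ = 5 := by simp
    calc _ ≤ |M| + 1 := by linarith [le_abs_self M]
      _ = (|M|+1) * 5 * 5⁻¹ := by ring
      _ ≤ (|M|+1) * 5 * (1 + |s.im|)^(-(3/4):ℝ) := by gcongr
      _ ≤ _ := by gcongr; linarith
  · have htpos : 0 < |s.im| := by linarith
    set ρ := rhoT s.im ^ 20 with hρ
    have hρ1 : 1 ≤ ρ := one_le_pow₀ (one_le_rhoT (by linarith))
    set r := c / (2 * ρ) with hr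
    have hr0 : 0 < r := by positivity
    have hr1 : r ≤ 1 := by
      rw [hr, div_le_one (by positivity)]; linarith
    have key : ∀ z ∈ Metric.closedBall s r, AnalyticAt ℂ (Haux a) z ∧ ‖Haux a z‖ ≤ 4 * B * (ρ / |s.im|) := by
      intro z hz
      rw [Metric.mem_closedBall, dist_eq_norm] at hz
      have hre := (Complex.abs_re_le_norm (z - s)).trans hz
      have him := (Complex.abs_im_le_norm (z - s)).trans hz
      rw [Complex.sub_re, abs_le] at hre
      rw [Complex.sub_im] at him
      have a1 : |z.im| ≤ 2 * |s.im| := by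
        have := abs_sub_abs_le_abs_sub z.im s.im
        linarith
      have a2 : |s.im| ≤ 2 * |z.im| := by
        have := abs_sub_abs_le_abs_sub s.im z.im
        rw [abs_sub_comm] at this
        linarith
      have a3 : rhoT z.im ^ 20 ≤ 2 * ρ := by
        rw [hρ, rhoT_pow_twenty, rhoT_pow_twenty]
        exact two_rpow_le a1 (by norm_num) (by norm_num)
      have a4 : 1 ≤ rhoT z.im ^ 20 := one_le_pow₀ (one_le_rhoT (by linarith))
      obtain ⟨b1, b2⟩ := h z (by linarith) (by
        have : r ≤ c / rhoT z.im ^ 20 := by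
          rw [hr]; gcongr
        linarith) (by linarith)
      refine ⟨b1, b2.trans ?_⟩
      rw [mul_div_assoc, show 4 * B * (ρ / |s.im|) = B * ((2*ρ) / (|s.im|/2)) by field_simp; ring]
      gcongr
      linarith
    have hd : DiffContOnCl ℂ (Haux a) (Metric.ball s r) := by
      refine DifferentiableOn.diffContOnCl fun z hz => ?_
      rw [closure_ball _ hr0.ne'] at hz
      exact (key z hz).1.differentiableAt.differentiableWithinAt
    have := Complex.norm_iteratedDeriv_le_of_forall_mem_sphere_norm_le 2 hr0 hd
      fun z hz => (key z (Metric.sphere_subset_closedBall hz)).2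
    refine this.trans ?_
    have e1 : ((Nat.factorial 2 : ℕ):ℝ) * (4 * B * (ρ / |s.im|)) / r^2 = K * (ρ^3 / |s.im|) := by
      rw [hr, hKdef]; norm_num [Nat.factorial]; field_simp; norm_num
    have e2 : ρ^3 / |s.im| = |s.im|^(-(3/4):ℝ) := by
      rw [hρ, rhoT_pow_twenty, ← Real.rpow_natCast, ← Real.rpow_mul htpos.le]
      nth_rewrite 2 [← Real.rpow_one |s.im|]
      rw [← Real.rpow_sub htpos]; norm_num
    have e3 : |s.im|^(-(3/4):ℝ) ≤ 2 * (1 + |s.im|)^(-(3/4):ℝ) := by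
      rw [Real.rpow_neg htpos.le, Real.rpow_neg (by positivity)]
      have : (1+|s.im|)^(3/4:ℝ) ≤ 2 * |s.im|^(3/4:ℝ) := by
        have := two_rpow_le (t := s.im) (u := 1 + |s.im|) (by rw [abs_of_pos (by positivity)]; linarith) (p := 3/4) (by norm_num) (by norm_num)
        rwa [abs_of_pos (by positivity)] at this
      rw [inv_le_iff_one_le_mul₀ (by positivity)]
      have h6 : 0 < (1+|s.im|)^(3/4:ℝ) := by positivity
      rw [show 2 * ((1 + |s.im|) ^ (3/4:ℝ))⁻¹ * |s.im| ^ (3/4:ℝ) = (2 * |s.im| ^ (3/4:ℝ)) / ((1 + |s.im|) ^ (3/4:ℝ)) by field_simp]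
      rwa [one_le_div h6]
    rw [e1, e2]
    calc _ ≤ K * (2 * (1 + |s.im|)^(-(3/4):ℝ)) := by gcongr
      _ = 2 * K * (1 + |s.im|)^(-(3/4):ℝ) := by ring
      _ ≤ _ := by gcongr; linarith [abs_nonneg M]

lemma Haux_eq {a : ZMod 8} (ha : IsUnit a) {s : ℂ} (hs : 1 < s.re) :
    Haux a s = LSeries (fun n => (residueClass a n : ℂ)) s / s - (4:ℂ)⁻¹ / (s - 1) := by
  have h1 : s - 1 ≠ 0 := by
    intro h; rw [sub_eq_zero] at h; rw [h] at hs; norm_num at hs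
  have h0 : s ≠ 0 := by rintro rfl; norm_num at hs
  have ht : Nat.totient 8 = 4 := by decide
  unfold Haux
  rw [eqOn_LFunctionResidueClassAux ha hs, ht]
  push_cast
  field_simp
  ring

end PartA3

section PartA4

open Complex Filter Topology
open ArithmeticFunction ArithmeticFunction.vonMangoldt DirichletCharacter MeasureTheory
open scoped FourierTransform SchwartzMap

noncomputable def psiA (a : ZMod 8) (x : ℝ) : ℝ := ∑ k ∈ Finset.Icc 1 ⌊x⌋₊, residueClass a k

lemma psiA_mono (a : ZMod 8) : Monotone (psiA a) := by
  intro x y h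
  unfold psiA
  exact Finset.sum_le_sum_of_subset_of_nonneg
    (Finset.Icc_subset_Icc_right (Nat.floor_mono h)) fun i _ _ => residueClass_nonneg a i

lemma psiA_nonneg (a : ZMod 8) (x : ℝ) : 0 ≤ psiA a x :=
  Finset.sum_nonneg fun i _ => residueClass_nonneg a i

lemma psiA_le (a : ZMod 8) {x : ℝ} (hx : 0 ≤ x) : psiA a x ≤ (Real.log 4 + 4) * x := by
  refine le_trans ?_ (Chebyshev.psi_le_const_mul_self hx)
  unfold psiA Chebyshev.psi
  exact Finset.sum_le_sum fun i _ => residueClass_le a i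

noncomputable def KA : ℝ := Real.log 4 + 5

lemma KA_pos : 5 ≤ KA := by
  unfold KA; linarith [Real.log_nonneg (x := 4) (by norm_num)]

noncomputable def eA (a : ZMod 8) (u : ℝ) : ℝ := psiA a (Real.exp u) * Real.exp (-u) - 1/4

lemma eA_meas (a : ZMod 8) : Measurable (eA a) := by
  unfold eA
  have : Measurable (psiA a) := (psiA_mono a).measurable
  fun_prop

lemma eA_lower (a : ZMod 8) (u : ℝ) : -(1/4) ≤ eA a u := by
  unfold eA
  have := mul_nonneg (psiA_nonneg a (Real.exp u)) (Real.exp_pos (-u)).le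
  linarith

lemma eA_bound (a : ZMod 8) (u : ℝ) : |eA a u| ≤ KA := by
  have h1 := eA_lower a u
  have h2 : psiA a (Real.exp u) * Real.exp (-u) ≤ Real.log 4 + 4 := by
    calc _ ≤ (Real.log 4 + 4) * Real.exp u * Real.exp (-u) := by
          gcongr; exact psiA_le a (Real.exp_pos u).le
      _ = _ := by rw [mul_assoc, ← Real.exp_add]; simp
  rw [abs_le]
  have := KA_pos
  constructor
  · linarith
  · unfold eA KA at *; linarith

lemma Haux_laplace {a : ZMod 8} (ha : IsUnit a) {s : ℂ} (hs : 1 < s.re) :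
    ∫ u in Set.Ioi (0:ℝ), (eA a u : ℂ) * cexp (-(s-1)*u) = Haux a s := by
  have h0 : s ≠ 0 := by rintro rfl; norm_num at hs
  have hre : (-(s-1)).re < 0 := by simp; linarith
  have hint1 : IntegrableOn (fun u:ℝ => cexp (-(s-1)*u)) (Set.Ioi 0) := integrableOn_exp_mul_complex_Ioi hre 0
  have hIntg : IntegrableOn (fun u:ℝ => ((eA a u : ℂ) + 1/4) * cexp (-(s-1)*u)) (Set.Ioi 0) := by
    refine Integrable.bdd_mul (c := KA + 1/4) hint1 ?_ ?_
    · have := eA_meas a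
      exact Measurable.aestronglyMeasurable (by fun_prop)
    · refine Eventually.of_forall fun u => ?_
      refine (norm_add_le _ _).trans ?_
      rw [Complex.norm_real]
      have := eA_bound a u
      rw [Real.norm_eq_abs]
      gcongr
      norm_num
  have e1 : ∫ u in Set.Ioi (0:ℝ), (eA a u : ℂ) * cexp (-(s-1)*u) =
      (∫ u in Set.Ioi (0:ℝ), ((eA a u : ℂ) + 1/4) * cexp (-(s-1)*u)) - ∫ u in Set.Ioi (0:ℝ), (1/4) * cexp (-(s-1)*u) := by
    rw [← integral_sub hIntg (hint1.const_mul _)]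
    congr 1; ext u; ring
  have hO : (fun n:ℕ ↦ ∑ k ∈ Finset.Icc 1 n, residueClass a k) =O[atTop] fun n:ℕ ↦ (n : ℝ) ^ (1:ℝ) := by
    refine Asymptotics.IsBigO.of_bound (Real.log 4 + 4) (Eventually.of_forall fun n => ?_)
    have := psiA_le a (x := n) (Nat.cast_nonneg n)
    have h2 := psiA_nonneg a n
    unfold psiA at this h2
    rw [Nat.floor_natCast] at this h2
    rw [Real.norm_of_nonneg h2, Real.rpow_one, Real.norm_of_nonneg (Nat.cast_nonneg n)]
    exact this
  have e2 : LSeries (fun n => (residueClass a n : ℂ)) s / s = ∫ u in Set.Ioi (0:ℝ), ((eA a u : ℂ) + 1/4) * cexp (-(s-1)*u) := by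
    rw [LSeries_eq_mul_integral_of_nonneg _ zero_le_one hs hO (residueClass_nonneg a), mul_div_cancel_left₀ _ h0]
    have him : Set.Ioi (1:ℝ) = Real.exp '' Set.Ioi 0 := by
      ext x
      simp only [Set.mem_Ioi, Set.mem_image]
      constructor
      · intro h; exact ⟨Real.log x, Real.log_pos h, Real.exp_log (by linarith)⟩
      · rintro ⟨y, hy, rfl⟩; exact Real.one_lt_exp_iff.mpr hy
    rw [him, integral_image_eq_integral_abs_deriv_smul measurableSet_Ioi
      (fun x _ => (Real.hasDerivAt_exp x).hasDerivWithinAt) Real.exp_injective.injOn]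
    refine setIntegral_congr_fun measurableSet_Ioi fun u hu => ?_
    simp only [real_smul]
    rw [abs_of_pos (Real.exp_pos u)]
    have : (∑ k ∈ Finset.Icc 1 ⌊Real.exp u⌋₊, (residueClass a k : ℂ)) = (psiA a (Real.exp u) : ℂ) := by
      unfold psiA; push_cast; rfl
    rw [this]
    unfold eA
    push_cast
    rw [Complex.cpow_def_of_ne_zero (Complex.exp_ne_zero _), ← Complex.ofReal_exp, ← Complex.ofReal_log (Real.exp_pos u).le,
      Real.log_exp]
    push_cast
    have : cexp (-(s-1)*u) = cexp u * cexp (u * (-(s+1))) * cexp u := by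
      rw [← Complex.exp_add, ← Complex.exp_add]; congr 1; ring
    rw [this, sub_add_cancel, Complex.exp_neg]
    field_simp
  rw [Haux_eq ha hs, e1, ← e2]
  congr 1
  rw [integral_const_mul, integral_exp_mul_complex_Ioi hre]
  simp
  field_simp
  rw [one_div, ← inv_neg, neg_sub, one_div]

noncomputable def fA (a : ZMod 8) (ε : ℝ) (u : ℝ) : ℝ :=
  (Set.Ioi (0:ℝ)).indicator (fun u => eA a u * Real.exp (-ε*u)) u

lemma fA_meas (a : ZMod 8) (ε : ℝ) : Measurable (fA a ε) := by
  unfold fA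
  have := eA_meas a
  exact Measurable.indicator (by fun_prop) measurableSet_Ioi

lemma fA_integrable (a : ZMod 8) {ε : ℝ} (hε : 0 < ε) (n : ℕ) : Integrable (fun u : ℝ => u^n * fA a ε u) := by
  have h1 : IntegrableOn (fun u : ℝ => u^(n:ℝ) * Real.exp (-ε*u)) (Set.Ioi 0) :=
    integrableOn_rpow_mul_exp_neg_mul_rpow (p := 1) (s := n) (b := ε) (by have : (0:ℝ) ≤ n := n.cast_nonneg
                                                                          linarith) zero_lt_one hε |>.congr_fun (fun x hx => by simp) measurableSet_Ioi
  have h2 : Integrable ((Set.Ioi (0:ℝ)).indicator (fun u : ℝ => u^(n:ℝ) * Real.exp (-ε*u))) := by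
    rwa [integrable_indicator_iff measurableSet_Ioi]
  refine Integrable.mono' (h2.const_mul KA) ?_ ?_
  · have := fA_meas a ε
    exact Measurable.aestronglyMeasurable (by fun_prop)
  · refine Eventually.of_forall fun u => ?_
    unfold fA
    by_cases hu : u ∈ Set.Ioi (0:ℝ)
    · rw [Set.indicator_of_mem hu, Set.indicator_of_mem hu, Real.norm_eq_abs, Real.rpow_natCast]
      have hu' : 0 < u := hu
      rw [abs_mul, abs_mul, abs_of_pos (Real.exp_pos _), abs_of_pos (pow_pos hu' n)]
      have := eA_bound a u
      calc _ = |eA a u| * (u^n * Real.exp (-ε*u)) := by ring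
        _ ≤ _ := by gcongr
    · rw [Set.indicator_of_notMem hu, Set.indicator_of_notMem hu]; simp

lemma fA_fourier {a : ZMod 8} (ha : IsUnit a) {ε : ℝ} (hε : 0 < ε) (t : ℝ) :
    𝓕 (fun u => (fA a ε u : ℂ)) t = Haux a (1 + ε + 2 * Real.pi * I * t) := by
  rw [Real.fourier_real_eq_integral_exp_smul, ← Haux_laplace ha (by simp [hε]), ← integral_indicator measurableSet_Ioi]
  congr 1; ext u
  unfold fA
  by_cases hu : u ∈ Set.Ioi (0:ℝ)
  · rw [Set.indicator_of_mem hu, Set.indicator_of_mem hu]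
    push_cast
    rw [smul_eq_mul, mul_left_comm, ← Complex.exp_add]
    congr 2; ring
  · rw [Set.indicator_of_notMem hu, Set.indicator_of_notMem hu]; simp

lemma fA_fourier2 {a : ZMod 8} (ha : IsUnit a) {ε : ℝ} (hε : 0 < ε) (t : ℝ) :
    𝓕 (fun u : ℝ => ((u^2 * fA a ε u : ℝ) : ℂ)) t = iteratedDeriv 2 (Haux a) (1 + ε + 2 * Real.pi * I * t) := by
  have hIntg : ∀ n : ℕ, Integrable (fun x : ℝ => x ^ n • (fA a ε x : ℂ)) := by
    intro n
    refine (fA_integrable a hε n).ofReal.congr (Eventually.of_forall fun u => ?_)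
    simp
  have h := Real.iteratedDeriv_fourier (f := fun u => (fA a ε u : ℂ)) (N := 2) (n := 2) (fun n _ => hIntg n) le_rfl
  have h1 : (𝓕 (fun u => (fA a ε u : ℂ))) = fun t : ℝ => Haux a (1 + ε + 2 * Real.pi * I * t) :=
    funext fun t => fA_fourier ha hε t
  have hcomp : ∀ (g : ℂ → ℂ), (∀ s : ℂ, 1 ≤ s.re → DifferentiableAt ℂ g s) → ∀ t : ℝ,
      HasDerivAt (fun t : ℝ => g (1 + ε + 2 * Real.pi * I * t)) (deriv g (1 + ε + 2 * Real.pi * I * t) * (2 * Real.pi * I)) t := by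
    intro g hg t
    have e1 : HasDerivAt (fun z : ℂ => 1 + (ε:ℂ) + 2 * Real.pi * I * z) (2 * Real.pi * I) (t:ℂ) := by
      simpa using ((hasDerivAt_id (t:ℂ)).const_mul (2 * (Real.pi:ℂ) * I)).const_add (1 + (ε:ℂ))
    have e2 := (hg (1 + ε + 2 * Real.pi * I * t) (by simp [hε.le])).hasDerivAt
    exact (e2.comp (t:ℂ) e1).comp_ofReal
  rw [h1] at h
  have h2 : iteratedDeriv 2 (fun t : ℝ => Haux a (1 + ε + 2 * Real.pi * I * t)) =
      fun t : ℝ => iteratedDeriv 2 (Haux a) (1 + ε + 2 * Real.pi * I * t) * (2 * Real.pi * I)^2 := by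
    rw [iteratedDeriv_succ, iteratedDeriv_one, iteratedDeriv_two_eq]
    have : deriv (fun t : ℝ => Haux a (1 + ε + 2 * Real.pi * I * t)) =
      fun t : ℝ => deriv (Haux a) (1 + ε + 2 * Real.pi * I * t) * (2 * Real.pi * I) :=
      funext fun t => (hcomp _ (fun s hs => (Haux_analyticAt' a hs).differentiableAt) t).deriv
    rw [this]
    funext t
    rw [((hcomp _ (fun s hs => (Haux_analyticAt' a hs).deriv.differentiableAt) t).mul_const (2 * Real.pi * I)).deriv]
    ring
  rw [h2] at h
  have h3 := congrFun h t
  have h4 : 𝓕 (fun x : ℝ ↦ (-2 * Real.pi * I * x) ^ 2 • (fA a ε x : ℂ)) t = (2 * Real.pi * I)^2 *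
      𝓕 (fun u : ℝ => ((u^2 * fA a ε u : ℝ) : ℂ)) t := by
    rw [Real.fourier_real_eq_integral_exp_smul, Real.fourier_real_eq_integral_exp_smul, ← integral_const_mul]
    congr 1; ext u
    simp only [smul_eq_mul]
    push_cast
    ring
  rw [h4] at h3
  have h5 : (2 * (Real.pi:ℂ) * I)^2 ≠ 0 := by
    refine pow_ne_zero _ (mul_ne_zero (mul_ne_zero two_ne_zero ?_) I_ne_zero)
    exact_mod_cast Real.pi_ne_zero
  exact mul_left_cancel₀ h5 (by rw [← h3]; ring)

lemma dual_bound {a : ZMod 8} (ha : IsUnit a) : ∃ C : ℝ, 0 < C ∧ ∀ δ : ℝ, 0 < δ → ∀ φ : 𝓢(ℝ, ℂ),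
    ∀ ε : ℝ, 0 < ε → ε ≤ 1 → ∫ x, ‖φ x‖^2 ≤ δ →
    ‖∫ u : ℝ, ((u^2 * fA a ε u : ℝ) : ℂ) * φ u‖ ≤ C * Real.sqrt δ := by
  obtain ⟨C, hC0, hC⟩ := Haux_dd_bound a
  have hJ : Integrable (fun t : ℝ => (1 + ‖t‖)^(-(3/2:ℝ))) := integrable_one_add_norm (by simp; norm_num)
  set J := ∫ t : ℝ, (1 + ‖t‖)^(-(3/2:ℝ)) with hJdef
  have hJ0 : 0 ≤ J := integral_nonneg fun t => by positivity
  refine ⟨C^2 * J + 1, by positivity, fun δ hδ φ ε hε hε1 hφ => ?_⟩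
  have hsd : 0 < Real.sqrt δ := Real.sqrt_pos.mpr hδ
  have hf : Integrable (fun u : ℝ => ((u^2 * fA a ε u : ℝ) : ℂ)) := (fA_integrable a hε 2).ofReal
  have hdual : ∫ u : ℝ, ((u^2 * fA a ε u : ℝ) : ℂ) * φ u = ∫ t : ℝ, 𝓕 (fun u : ℝ => ((u^2 * fA a ε u : ℝ) : ℂ)) t * (𝓕⁻ φ) t := by
    have h := VectorFourier.integral_fourierIntegral_smul_eq_flip (L := innerₗ ℝ) (μ := volume) (ν := volume)
      Real.continuous_fourierChar continuous_inner hf (𝓕⁻ φ).integrable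
    have e : 𝓕 (𝓕⁻ φ) = φ := FourierTransform.fourier_fourierInv_eq φ
    have h' : ∫ ξ : ℝ, 𝓕 (fun u : ℝ => ((u^2 * fA a ε u : ℝ) : ℂ)) ξ • (𝓕⁻ φ) ξ = ∫ x, ((x^2 * fA a ε x : ℝ) : ℂ) • (𝓕 (𝓕⁻ φ)) x := by
      rw [flip_innerₗ] at h
      rw [SchwartzMap.fourier_coe]
      exact h
    rw [e] at h'
    simpa using h'.symm
  have hpl : ∫ x, ‖(𝓕⁻ φ) x‖^2 ≤ δ := by
    have := SchwartzMap.integral_norm_sq_fourier (𝓕⁻ φ)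
    rw [FourierTransform.fourier_fourierInv_eq φ] at this
    rw [← this]; exact hφ
  have hsq : Integrable (fun x => ‖(𝓕⁻ φ) x‖^2) := by
    have := ((𝓕⁻ φ).memLp 2 volume).integrable_norm_pow (by norm_num)
    simpa using this
  rw [hdual]
  have hb : ∀ t : ℝ, ‖𝓕 (fun u : ℝ => ((u^2 * fA a ε u : ℝ) : ℂ)) t * (𝓕⁻ φ) t‖ ≤
      Real.sqrt δ * (C^2 * (1 + ‖t‖)^(-(3/2:ℝ))) + (Real.sqrt δ)⁻¹ * ‖(𝓕⁻ φ) t‖^2 := by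
    intro t
    rw [norm_mul, fA_fourier2 ha hε]
    have h1 := hC (1 + ε + 2 * Real.pi * I * t) (by simp [hε.le]) (by simp; linarith)
    have h2 : (1 + |((1:ℂ) + ε + 2 * Real.pi * I * t).im|)^(-(3/4):ℝ) ≤ (1 + ‖t‖)^(-(3/4):ℝ) := by
      refine Real.rpow_le_rpow_of_nonpos (by positivity) ?_ (by norm_num)
      have : ((1:ℂ) + ε + 2 * Real.pi * I * t).im = 2 * Real.pi * t := by simp
      rw [this, abs_mul, Real.norm_eq_abs, abs_of_pos (a := 2 * Real.pi) (by positivity)]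
      have := Real.pi_gt_three
      nlinarith [abs_nonneg t]
    have h3 : (1 + ‖t‖)^(-(3/2:ℝ)) = ((1 + ‖t‖)^(-(3/4):ℝ))^2 := by
      rw [← Real.rpow_natCast, ← Real.rpow_mul (by positivity)]; norm_num
    rw [h3]
    set w := (1 + ‖t‖)^(-(3/4):ℝ)
    have h4 : ‖iteratedDeriv 2 (Haux a) (1 + ε + 2 * Real.pi * I * t)‖ ≤ C * w := h1.trans (by gcongr)
    have hw : 0 ≤ w := by positivity
    set g := ‖(𝓕⁻ φ) t‖
    have hg : 0 ≤ g := norm_nonneg _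
    calc _ ≤ (C * w) * g := by gcongr
      _ ≤ _ := by
        have h6 : Real.sqrt δ * (C^2 * w^2) + (Real.sqrt δ)⁻¹ * g^2 - C * w * g =
          (Real.sqrt δ)⁻¹ * ((Real.sqrt δ * (C * w) - g/2)^2 + 3/4*g^2) := by field_simp; ring
        have : 0 ≤ (Real.sqrt δ)⁻¹ * ((Real.sqrt δ * (C * w) - g/2)^2 + 3/4*g^2) := by positivity
        linarith
  have hi1 : Integrable (fun t : ℝ => Real.sqrt δ * (C^2 * (1 + ‖t‖)^(-(3/2:ℝ)))) := (hJ.const_mul _).const_mul _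
  have hi2 : Integrable (fun t : ℝ => (Real.sqrt δ)⁻¹ * ‖(𝓕⁻ φ) t‖^2) := hsq.const_mul _
  refine (norm_integral_le_of_norm_le (hi1.add hi2) (Eventually.of_forall hb)).trans ?_
  have : ∫ t : ℝ, ((fun t : ℝ => Real.sqrt δ * (C^2 * (1 + ‖t‖)^(-(3/2:ℝ)))) + (fun t : ℝ => (Real.sqrt δ)⁻¹ * ‖(𝓕⁻ φ) t‖^2) : ℝ → ℝ) t
      = Real.sqrt δ * (C^2 * J) + (Real.sqrt δ)⁻¹ * ∫ x, ‖(𝓕⁻ φ) x‖^2 := by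
    rw [integral_add' hi1 hi2, integral_const_mul, integral_const_mul, integral_const_mul]
  rw [this]
  have h7 : (Real.sqrt δ)⁻¹ * ∫ x, ‖(𝓕⁻ φ) x‖^2 ≤ Real.sqrt δ := by
    calc _ ≤ (Real.sqrt δ)⁻¹ * δ := by gcongr
      _ = Real.sqrt δ := by rw [inv_mul_eq_div, Real.div_sqrt]
  linarith

end PartA4

section PartA5

open Complex Filter Topology
open ArithmeticFunction ArithmeticFunction.vonMangoldt DirichletCharacter MeasureTheory
open scoped FourierTransform SchwartzMap ContDiff

lemma bump_lower {a : ZMod 8} (ha : IsUnit a) : ∃ C : ℝ, 0 < C ∧ ∀ u0 δ w σ m : ℝ, 2 ≤ u0 → 0 < δ →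
    u0 - 1 ≤ w - δ/2 → w + δ/2 ≤ u0 + 1 → |σ| = 1 → 0 ≤ m →
    (∀ u, w - δ/2 ≤ u → u ≤ w + δ/2 → m ≤ σ * eA a u) → m * u0^2 * Real.sqrt δ ≤ C := by
  obtain ⟨C, hC0, hC⟩ := dual_bound ha
  refine ⟨C * (8 * Real.exp 2), by positivity, fun u0 δ w σ m hu0 hδ hw1 hw2 hσ hm hle => ?_⟩
  let b : ContDiffBump w := ⟨δ/4, δ/2, by positivity, by linarith⟩
  have hbs : HasCompactSupport (fun x => ((b x : ℝ) : ℂ)) :=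
    b.hasCompactSupport.comp_left (g := fun x : ℝ => (x:ℂ)) Complex.ofReal_zero
  have hbd : ContDiff ℝ ∞ (fun x => ((b x : ℝ) : ℂ)) := Complex.ofRealCLM.contDiff.comp b.contDiff
  let φ : 𝓢(ℝ, ℂ) := hbs.toSchwartzMap hbd
  have hφ : ∀ x, φ x = ((b x : ℝ) : ℂ) := fun x => rfl
  have hb0 : ∀ x, x ∉ Set.Icc (w - δ/2) (w + δ/2) → b x = 0 := by
    intro x hx
    apply b.zero_of_le_dist
    show δ/2 ≤ dist x w
    rw [Real.dist_eq]
    by_contra h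
    push Not at h
    rw [abs_lt] at h
    exact hx ⟨by linarith, by linarith⟩
  have hb1 : ∀ x ∈ Set.Icc (w - δ/4) (w + δ/4), b x = 1 := by
    intro x hx
    apply b.one_of_mem_closedBall
    show dist x w ≤ δ/4
    rw [Real.dist_eq, abs_le]
    exact ⟨by linarith [hx.1], by linarith [hx.2]⟩
  have hL2 : ∫ x, ‖φ x‖^2 ≤ δ := by
    calc ∫ x, ‖φ x‖^2 ≤ ∫ x, (Set.Icc (w - δ/2) (w + δ/2)).indicator (fun _ => (1:ℝ)) x := by
          refine integral_mono_of_nonneg (Eventually.of_forall fun x => by positivity) ?_ (Eventually.of_forall fun x => ?_)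
          · rw [integrable_indicator_iff measurableSet_Icc]
            simp
          · show ‖φ x‖^2 ≤ _
            rw [hφ, Complex.norm_real]
            by_cases hx : x ∈ Set.Icc (w - δ/2) (w + δ/2)
            · rw [Set.indicator_of_mem hx, Real.norm_of_nonneg b.nonneg]
              exact pow_le_one₀ b.nonneg b.le_one
            · rw [Set.indicator_of_notMem hx, hb0 x hx]; simp
      _ = δ := by
          rw [integral_indicator_const _ measurableSet_Icc]
          simp [hδ.le]
  have hε : 0 < 1/u0 := by positivity
  have main := hC δ hδ φ (1/u0) hε (by rw [div_le_one (by linarith)]; linarith) hL2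
  have e1 : ∫ u : ℝ, ((u^2 * fA a (1/u0) u : ℝ) : ℂ) * φ u = ((∫ u : ℝ, u^2 * fA a (1/u0) u * b u : ℝ) : ℂ) := by
    rw [← integral_complex_ofReal]
    congr 1; ext u; rw [hφ]; push_cast; ring
  rw [e1, Complex.norm_real, Real.norm_eq_abs] at main
  set κ := u0^2/4 * m * Real.exp (-2) with hκ
  have hκ0 : 0 ≤ κ := by positivity
  have hIntg : Integrable (fun u : ℝ => u^2 * fA a (1/u0) u * b u) := by
    refine Integrable.mul_bdd (c := 1) (fA_integrable a hε 2) b.continuous.aestronglyMeasurable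
      (Eventually.of_forall fun x => ?_)
    rw [Real.norm_of_nonneg b.nonneg]; exact b.le_one
  have hpt : ∀ u, (Set.Icc (w - δ/4) (w + δ/4)).indicator (fun _ => κ) u ≤ σ * (u^2 * fA a (1/u0) u * b u) := by
    intro u
    by_cases hu : u ∈ Set.Icc (w - δ/2) (w + δ/2)
    · have hupos : 0 < u := by linarith [hu.1]
      have hf : fA a (1/u0) u = eA a u * Real.exp (-(1/u0)*u) := by
        unfold fA; rw [Set.indicator_of_mem]; exact hupos
      have hl := hle u hu.1 hu.2
      have hbn : 0 ≤ b u := b.nonneg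
      rw [hf]
      by_cases hu2 : u ∈ Set.Icc (w - δ/4) (w + δ/4)
      · rw [Set.indicator_of_mem hu2, hb1 u hu2]
        have h1 : u0^2/4 ≤ u^2 := by
          have : u0/2 ≤ u := by linarith [hu.1]
          nlinarith
        have h2 : Real.exp (-2) ≤ Real.exp (-(1/u0)*u) := by
          apply Real.exp_le_exp.mpr
          have : u / u0 ≤ 2 := by rw [div_le_iff₀ (by linarith)]; linarith [hu.2]
          have : -(1/u0)*u = -(u/u0) := by ring
          linarith
        calc κ ≤ u^2 * (σ * eA a u) * Real.exp (-(1/u0)*u) := by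
              rw [hκ]; gcongr
              exact mul_nonneg (sq_nonneg u) (hm.trans hl)
          _ = _ := by ring
      · rw [Set.indicator_of_notMem hu2]
        have : 0 ≤ u^2 * (σ * eA a u) * Real.exp (-(1/u0)*u) * b u := by
          have := hm.trans hl
          positivity
        calc 0 ≤ _ := this
          _ = _ := by ring
    · rw [hb0 u hu, Set.indicator_of_notMem]
      · simp
      · intro h; exact hu ⟨by linarith [h.1], by linarith [h.2]⟩
  have hI : κ * (δ/2) ≤ σ * ∫ u : ℝ, u^2 * fA a (1/u0) u * b u := by
    rw [← integral_const_mul]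
    have : ∫ u, (Set.Icc (w - δ/4) (w + δ/4)).indicator (fun _ => κ) u = κ * (δ/2) := by
      rw [integral_indicator_const _ measurableSet_Icc]
      simp
      rw [max_eq_left (by linarith)]; ring
    rw [← this]
    refine integral_mono ?_ (hIntg.const_mul _) hpt
    rw [integrable_indicator_iff measurableSet_Icc]
    simp
  have hJ : κ * (δ/2) ≤ C * Real.sqrt δ := by
    refine hI.trans (le_trans (le_abs_self _) ?_)
    rw [abs_mul, hσ, one_mul]; exact main
  have hs : 0 < Real.sqrt δ := Real.sqrt_pos.mpr hδ
  have hss : Real.sqrt δ * Real.sqrt δ = δ := Real.mul_self_sqrt hδ.le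
  have h3 : κ * Real.sqrt δ / 2 ≤ C := by
    refine le_of_mul_le_mul_right ?_ hs
    calc _ = κ * ((Real.sqrt δ * Real.sqrt δ)/2) := by ring
      _ ≤ _ := by rw [hss]; exact hJ
  have h4 : m * u0^2 * Real.sqrt δ = (κ * Real.sqrt δ / 2) * (8 * Real.exp 2) := by
    rw [hκ, Real.exp_neg]; field_simp; ring
  rw [h4]; gcongr

lemma eA_decay {a : ZMod 8} (ha : IsUnit a) : ∃ C : ℝ, 0 < C ∧ ∀ u : ℝ, 2 ≤ u → |eA a u| ≤ C * u^(-(4/3):ℝ) := by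
  obtain ⟨C, hC0, hC⟩ := bump_lower ha
  have hK := KA_pos
  set c := (2 * Real.sqrt (2 * (KA + 1)) * C) with hc
  have hc0 : 0 < c := by positivity
  refine ⟨c^(2/3:ℝ), by positivity, fun u0 hu0 => ?_⟩
  rcases eq_or_ne (eA a u0) 0 with h0 | h0
  · rw [h0, abs_zero]; positivity
  set η := |eA a u0| with hη
  have hη0 : 0 < η := abs_pos.mpr h0
  have hηK : η ≤ KA := eA_bound a u0
  set δ := η / (2 * (KA+1)) with hδ
  have hδ0 : 0 < δ := by positivity
  have hδ1 : δ ≤ 1 := by rw [hδ, div_le_one (by positivity)]; linarith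
  have hδη : δ * (KA + 1) = η/2 := by rw [hδ]; field_simp
  have hmono : ∀ u v, u ≤ v → (eA a u + 1/4) * Real.exp u ≤ (eA a v + 1/4) * Real.exp v := by
    intro u v huv
    have : ∀ u, (eA a u + 1/4) * Real.exp u = psiA a (Real.exp u) := by
      intro u; unfold eA; rw [sub_add_cancel, mul_assoc, ← Real.exp_add]; simp
    rw [this, this]; exact psiA_mono a (Real.exp_le_exp.mpr huv)
  have key : η/2 * u0^2 * Real.sqrt δ ≤ C := by
    rcases lt_or_gt_of_ne h0 with hneg | hpos
    · have hηe : eA a u0 = -η := by rw [hη, abs_of_neg hneg]; ring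
      refine hC u0 δ (u0 - δ/2) (-1) (η/2) hu0 hδ0 (by linarith) (by linarith) (by simp) (by positivity) fun u h1 h2 => ?_
      have h3 := hmono u u0 (by linarith)
      rw [hηe] at h3
      have h4 : Real.exp u0 = Real.exp u * Real.exp (u0 - u) := by rw [← Real.exp_add]; congr 1; ring
      have h5 : Real.exp (u0 - u) ≤ 1 + 2 * δ := by
        have hx : 0 ≤ u0 - u := by linarith
        have hx1 : u0 - u ≤ δ := by linarith
        have := Real.abs_exp_sub_one_le (x := u0 - u) (by rw [abs_of_nonneg hx]; linarith)
        rw [abs_of_nonneg hx] at this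
        linarith [le_abs_self (Real.exp (u0-u) - 1)]
      have h6 : eA a u + 1/4 ≤ (-η + 1/4) * Real.exp (u0 - u) := by
        rw [h4] at h3
        refine le_of_mul_le_mul_right (h3.trans (le_of_eq ?_)) (Real.exp_pos u)
        ring
      have h7 : 0 ≤ -η + 1/4 := by linarith [eA_lower a u0]
      have h8 : eA a u + 1/4 ≤ (-η + 1/4) * (1 + 2*δ) := h6.trans (by gcongr)
      nlinarith [mul_pos hη0 hδ0]
    · have hηe : eA a u0 = η := by rw [hη, abs_of_pos hpos]
      refine hC u0 δ (u0 + δ/2) 1 (η/2) hu0 hδ0 (by linarith) (by linarith) (by simp) (by positivity) fun u h1 h2 => ?_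
      have h3 := hmono u0 u (by linarith)
      rw [hηe] at h3
      have h4 : Real.exp u0 = Real.exp u * Real.exp (u0 - u) := by rw [← Real.exp_add]; congr 1; ring
      have h5 : 1 - δ ≤ Real.exp (u0 - u) := by
        have := Real.add_one_le_exp (u0 - u)
        linarith
      have h6 : (η + 1/4) * Real.exp (u0 - u) ≤ eA a u + 1/4 := by
        rw [h4] at h3
        refine le_of_mul_le_mul_right ((le_of_eq ?_).trans h3) (Real.exp_pos u)
        ring
      have h8 : (η + 1/4) * (1 - δ) ≤ eA a u + 1/4 := le_trans (by gcongr) h6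
      nlinarith
  have hsd : Real.sqrt δ = Real.sqrt η / Real.sqrt (2*(KA+1)) := by rw [hδ, Real.sqrt_div hη0.le]
  have hq : 0 < Real.sqrt (2*(KA+1)) := by positivity
  have k2 : η * Real.sqrt η ≤ c * u0^(-2:ℝ) := by
    rw [Real.rpow_neg (by linarith), show (2:ℝ) = ((2:ℕ):ℝ) by norm_num, Real.rpow_natCast, ← div_eq_mul_inv, le_div_iff₀ (by positivity), hc]
    calc _ = 2 * Real.sqrt (2*(KA+1)) * (η/2 * u0^2 * Real.sqrt δ) := by rw [hsd]; field_simp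
      _ ≤ _ := by gcongr
  have k3 : η = (η * Real.sqrt η)^(2/3:ℝ) := by
    have : η * Real.sqrt η = η^(3/2:ℝ) := by
      rw [Real.sqrt_eq_rpow]
      nth_rewrite 1 [← Real.rpow_one η]
      rw [← Real.rpow_add hη0]; norm_num
    rw [this, ← Real.rpow_mul hη0.le]; norm_num
  rw [k3]
  calc _ ≤ (c * u0^(-2:ℝ))^(2/3:ℝ) := by gcongr
    _ = _ := by
      rw [Real.mul_rpow hc0.le (by positivity), ← Real.rpow_mul (by linarith)]; norm_num

/-- Chebyshev theta function restricted to a residue class mod 8. -/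
noncomputable def thA (a : ZMod 8) (x : ℝ) : ℝ :=
  ∑ k ∈ Finset.Icc 1 ⌊x⌋₊, if k.Prime ∧ (k : ZMod 8) = a then Real.log k else 0

lemma psiA_sub_thA (a : ZMod 8) {x : ℝ} (hx : 1 ≤ x) : |psiA a x - thA a x| ≤ 2 * Real.sqrt x * Real.log x := by
  have h := Chebyshev.psi_sub_theta_le hx
  rw [Chebyshev.psi_sub_theta_eq_sum_not_prime] at h
  refine le_trans ?_ h
  unfold psiA thA
  rw [← Finset.sum_sub_distrib, Finset.sum_filter]
  refine (Finset.abs_sum_le_sum_abs _ _).trans (Finset.sum_le_sum fun k _ => ?_)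
  by_cases hk : k.Prime
  · simp only [hk, true_and, not_true, if_false]
    unfold residueClass
    by_cases hk2 : (k : ZMod 8) = a
    · rw [Set.indicator_of_mem (by exact hk2), if_pos hk2, ArithmeticFunction.vonMangoldt_apply_prime hk]; simp
    · rw [Set.indicator_of_notMem (by exact hk2), if_neg hk2]; simp
  · simp only [hk, false_and, if_false, not_false_iff, if_true, sub_zero]
    rw [abs_of_nonneg (residueClass_nonneg a k)]
    exact residueClass_le a k

lemma sqrt_log_le {x : ℝ} (hx : 1 ≤ x) : Real.sqrt x * Real.log x ≤ 648 * (x * (1 + Real.log x)^(-(4/3):ℝ)) := by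
  set u := Real.log x with hu
  have hu0 : 0 ≤ u := Real.log_nonneg hx
  have hx' : x = Real.exp u := (Real.exp_log (by linarith)).symm
  have hsq : Real.sqrt x = Real.exp (u/2) := by
    rw [hx', Real.sqrt_eq_rpow, ← Real.exp_mul]; congr 1; ring
  rw [Real.rpow_neg (by positivity), ← div_eq_mul_inv, ← mul_div_assoc, le_div_iff₀ (by positivity)]
  have h1 : u * (1+u)^(4/3:ℝ) ≤ (1+u)^3 := by
    have : (1+u)^(4/3:ℝ) ≤ (1+u)^2 := by
      rw [← Real.rpow_natCast]
      exact Real.rpow_le_rpow_of_exponent_le (by linarith) (by norm_num)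
    calc _ ≤ (1+u) * (1+u)^2 := by gcongr; linarith
      _ = _ := by ring
  have h2 : (1+u)^3 ≤ 648 * Real.exp (u/2) := by
    have h3 : (1+u)/6 ≤ Real.exp ((1+u)/6) := by linarith [Real.add_one_le_exp ((1+u)/6)]
    have h4 : ((1+u)/6)^3 ≤ Real.exp ((1+u)/6)^3 := by gcongr
    have h5 : Real.exp ((1+u)/6)^3 = Real.exp (1/2) * Real.exp (u/2) := by
      rw [← Real.exp_nat_mul, ← Real.exp_add]; congr 1; push_cast; ring
    have h6 : Real.exp (1/2) ≤ 3 := (Real.exp_le_exp.mpr (by norm_num)).trans (by linarith [Real.exp_one_lt_d9] : Real.exp 1 ≤ 3)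
    have h7 : (1+u)^3 = 216 * ((1+u)/6)^3 := by ring
    have := Real.exp_pos (u/2)
    rw [h7]
    nlinarith
  have hxx : x = Real.sqrt x * Real.sqrt x := (Real.mul_self_sqrt (by linarith)).symm
  calc _ = Real.sqrt x * (u * (1+u)^(4/3:ℝ)) := by ring
    _ ≤ Real.sqrt x * (648 * Real.sqrt x) := by rw [hsq]; exact mul_le_mul_of_nonneg_left (h1.trans h2) (Real.exp_pos _).le
    _ = 648 * (Real.sqrt x * Real.sqrt x) := by ring
    _ = 648 * x := by rw [← hxx]

lemma thA_bound {a : ZMod 8} (ha : IsUnit a) : ∃ C : ℝ, 0 < C ∧ ∀ x : ℝ, 1 ≤ x →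
    |thA a x - x/4| ≤ C * (x * (1 + Real.log x)^(-(4/3):ℝ)) := by
  obtain ⟨C, hC0, hC⟩ := eA_decay ha
  have hK := KA_pos
  refine ⟨C * 2 + KA * 9 + 1296, by positivity, fun x hx => ?_⟩
  set u := Real.log x with hu
  have hu0 : 0 ≤ u := Real.log_nonneg hx
  have hx0 : 0 < x := by linarith
  have hx' : Real.exp u = x := Real.exp_log hx0
  have h1 : |psiA a x - x/4| = x * |eA a u| := by
    unfold eA
    rw [hx', Real.exp_neg, hx']
    nth_rewrite 3 [← abs_of_pos hx0]
    rw [← abs_mul]; congr 1; field_simp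
  have h2 : |eA a u| ≤ (C * 2 + KA * 9) * (1+u)^(-(4/3):ℝ) := by
    rcases le_total u 2 with h | h
    · have : (9:ℝ)⁻¹ ≤ (1+u)^(-(4/3):ℝ) := by
        rw [Real.rpow_neg (by positivity)]
        refine inv_anti₀ (by positivity) ?_
        calc (1+u)^(4/3:ℝ) ≤ 3^(4/3:ℝ) := by gcongr; linarith
          _ ≤ 3^(2:ℝ) := Real.rpow_le_rpow_of_exponent_le (by norm_num) (by norm_num)
          _ = 9 := by norm_num
      calc |eA a u| ≤ KA * 9 * 9⁻¹ := by rw [mul_assoc]; norm_num; exact eA_bound a u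
        _ ≤ KA * 9 * (1+u)^(-(4/3):ℝ) := by gcongr
        _ ≤ _ := by gcongr; linarith
    · have h3 : u^(-(4/3):ℝ) ≤ 2 * (1+u)^(-(4/3):ℝ) := by
        have h4 : (1+u) ≤ (3/2) * u := by linarith
        have h5 : ((3/2) * u)^(-(4/3):ℝ) ≤ (1+u)^(-(4/3):ℝ) := Real.rpow_le_rpow_of_nonpos (by positivity) h4 (by norm_num)
        rw [Real.mul_rpow (by norm_num) hu0] at h5
        have h6 : (1/2:ℝ) ≤ (3/2:ℝ)^(-(4/3):ℝ) := by
          rw [Real.rpow_neg (by norm_num), one_div]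
          refine inv_anti₀ (by positivity) ?_
          have e : (3/2:ℝ)^(4/3:ℝ) = ((3/2:ℝ)^4)^(1/3:ℝ) := by
            rw [← Real.rpow_natCast, ← Real.rpow_mul (by norm_num)]; norm_num
          have e2 : (2:ℝ) = ((2:ℝ)^3)^(1/3:ℝ) := by
            rw [← Real.rpow_natCast, ← Real.rpow_mul (by norm_num)]; norm_num
          rw [e, e2]
          refine Real.rpow_le_rpow (by positivity) (by norm_num) (by norm_num)
        have h7 : 0 ≤ u^(-(4/3):ℝ) := by positivity
        nlinarith
      calc _ ≤ C * u^(-(4/3):ℝ) := hC u h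
        _ ≤ C * (2 * (1+u)^(-(4/3):ℝ)) := by gcongr
        _ = C * 2 * (1+u)^(-(4/3):ℝ) := by ring
        _ ≤ _ := by gcongr; linarith
  have h3 := psiA_sub_thA a hx
  have h4 := sqrt_log_le hx
  have h5 : |thA a x - x/4| ≤ |psiA a x - x/4| + |psiA a x - thA a x| := by
    rw [abs_sub_comm (psiA a x) (thA a x)]
    have := abs_add_le (psiA a x - x/4) (thA a x - psiA a x)
    simpa using this
  rw [h1] at h5
  calc _ ≤ x * ((C * 2 + KA * 9) * (1+u)^(-(4/3):ℝ)) + 2 * (648 * (x * (1 + u)^(-(4/3):ℝ))) := by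
        refine h5.trans (add_le_add (by gcongr) ?_)
        linarith
    _ = _ := by ring

end PartA5

section PartB1

noncomputable def fB (n : ℕ) : ℝ := by
  classical
  exact if Squarefree n ∧ ∀ p : ℕ, p.Prime → p ∣ n → (p % 8 = 1 ∨ p % 8 = 7) then 1 else 0

lemma fB_one : fB 1 = 1 := by
  unfold fB
  rw [if_pos]
  refine ⟨squarefree_one, fun p hp h => ?_⟩
  exact absurd (Nat.dvd_one.mp h) hp.one_lt.ne'

lemma fB_zero : fB 0 = 0 := by
  unfold fB
  rw [if_neg]
  rintro ⟨h, -⟩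
  exact not_squarefree_zero h

lemma fB_nonneg (n : ℕ) : 0 ≤ fB n := by unfold fB; split_ifs <;> norm_num
lemma fB_le_one (n : ℕ) : fB n ≤ 1 := by unfold fB; split_ifs <;> norm_num

lemma fB_mul {m n : ℕ} (h : m.Coprime n) : fB (m * n) = fB m * fB n := by
  unfold fB
  have : (Squarefree (m*n) ∧ ∀ p : ℕ, p.Prime → p ∣ m*n → (p % 8 = 1 ∨ p % 8 = 7)) ↔
     ((Squarefree m ∧ ∀ p : ℕ, p.Prime → p ∣ m → (p % 8 = 1 ∨ p % 8 = 7)) ∧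
      (Squarefree n ∧ ∀ p : ℕ, p.Prime → p ∣ n → (p % 8 = 1 ∨ p % 8 = 7))) := by
    rw [Nat.squarefree_mul h]
    constructor
    · rintro ⟨⟨h1, h2⟩, h3⟩
      exact ⟨⟨h1, fun p hp hd => h3 p hp (hd.mul_right _)⟩, ⟨h2, fun p hp hd => h3 p hp (hd.mul_left _)⟩⟩
    · rintro ⟨⟨h1, h2⟩, ⟨h3, h4⟩⟩
      refine ⟨⟨h1, h3⟩, fun p hp hd => ?_⟩
      rcases (hp.dvd_mul).mp hd with h | h
      exacts [h2 p hp h, h4 p hp h]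
  by_cases h1 : (Squarefree m ∧ ∀ p : ℕ, p.Prime → p ∣ m → (p % 8 = 1 ∨ p % 8 = 7))
  · by_cases h2 : (Squarefree n ∧ ∀ p : ℕ, p.Prime → p ∣ n → (p % 8 = 1 ∨ p % 8 = 7))
    · rw [if_pos (this.mpr ⟨h1, h2⟩), if_pos h1, if_pos h2, mul_one]
    · rw [if_neg (fun h => h2 (this.mp h).2), if_neg h2, mul_zero]
  · rw [if_neg (fun h => h1 (this.mp h).1), if_neg h1, zero_mul]

lemma fB_eq_zero {n : ℕ} (h : ¬ Squarefree n) : fB n = 0 := by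
  unfold fB; rw [if_neg (fun h' => h h'.1)]

lemma fB_mul_dvd {p m : ℕ} (hp : p.Prime) (h : p ∣ m) : fB (p * m) = 0 := by
  apply fB_eq_zero
  intro hs
  have := hs p (mul_dvd_mul_left p h)
  exact hp.one_lt.ne' (Nat.isUnit_iff.mp this)

lemma fB_prime {p : ℕ} (hp : p.Prime) : fB p = if p % 8 = 1 ∨ p % 8 = 7 then 1 else 0 := by
  unfold fB
  congr 1
  rw [eq_iff_iff]
  constructor
  · exact fun h => h.2 p hp dvd_rfl
  · refine fun h => ⟨hp.squarefree, fun q hq hd => ?_⟩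
    rwa [(Nat.prime_dvd_prime_iff_eq hq hp).mp hd]

lemma fB_prime_mul {p m : ℕ} (hp : p.Prime) :
    fB (p * m) = fB p * fB m - if p ∣ m then fB p * fB m else 0 := by
  split_ifs with h
  · rw [fB_mul_dvd hp h]; ring
  · rw [fB_mul ((Nat.Prime.coprime_iff_not_dvd hp).mpr h)]; ring

lemma fB_prime_mul_le {p m : ℕ} (hp : p.Prime) : fB (p * m) ≤ fB m := by
  have h1 := fB_nonneg m
  by_cases h : p ∣ m
  · rw [fB_mul_dvd hp h]; exact h1
  · rw [fB_mul ((Nat.Prime.coprime_iff_not_dvd hp).mpr h)]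
    nlinarith [fB_le_one p]

/-- twisted indicator -/
noncomputable def hB (X : ℕ → ℝ) (n : ℕ) : ℝ := fB n * X n

noncomputable def SB (x : ℝ) : ℝ := ∑ n ∈ Finset.Icc 1 ⌊x⌋₊, fB n
noncomputable def TB (X : ℕ → ℝ) (x : ℝ) : ℝ := ∑ n ∈ Finset.Icc 1 ⌊x⌋₊, hB X n
noncomputable def ThB (X : ℕ → ℝ) (x : ℝ) : ℝ :=
  ∑ p ∈ Finset.Icc 1 ⌊x⌋₊, if p.Prime then Real.log p * hB X p else 0
noncomputable def DfB (X : ℕ → ℝ) (x : ℝ) : ℝ :=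
  ∑ m ∈ Finset.Icc 1 ⌊x⌋₊, ∑ p ∈ Finset.Icc 1 ⌊x / m⌋₊,
    if p.Prime then (if p ∣ m then Real.log p * (hB X p * hB X m) else 0) else 0

lemma abs_hB_le {X : ℕ → ℝ} (hX1 : ∀ n, |X n| ≤ 1) (n : ℕ) : |hB X n| ≤ fB n := by
  unfold hB
  rw [abs_mul, abs_of_nonneg (fB_nonneg n)]
  nlinarith [hX1 n, fB_nonneg n]

lemma hyperbola (F : ℕ → ℕ → ℝ) (N : ℕ) :
    ∑ n ∈ Finset.Icc 1 N, ∑ p ∈ n.primeFactors, F p (n / p) =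
    ∑ m ∈ Finset.Icc 1 N, ∑ p ∈ Finset.Icc 1 (N / m), if p.Prime then F p m else 0 := by
  simp_rw [← Finset.sum_filter]
  rw [Finset.sum_sigma', Finset.sum_sigma']
  refine Finset.sum_bij' (fun a _ => ⟨a.1 / a.2, a.2⟩) (fun a _ => ⟨a.1 * a.2, a.2⟩) ?_ ?_ ?_ ?_ ?_
  · rintro ⟨n, p⟩ h
    simp only [Finset.mem_sigma, Finset.mem_Icc, Nat.mem_primeFactors, Finset.mem_filter] at h ⊢
    obtain ⟨⟨h1, h2⟩, h3, h4, h5⟩ := h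
    have hq : 0 < n / p := Nat.div_pos (Nat.le_of_dvd h1 h4) h3.pos
    refine ⟨⟨hq, (Nat.div_le_self _ _).trans h2⟩, ⟨h3.pos, ?_⟩, h3⟩
    rw [Nat.le_div_iff_mul_le hq, Nat.mul_div_cancel' h4]; exact h2
  · rintro ⟨m, p⟩ h
    simp only [Finset.mem_sigma, Finset.mem_Icc, Nat.mem_primeFactors, Finset.mem_filter] at h ⊢
    obtain ⟨⟨h1, h2⟩, ⟨h3, h4⟩, h5⟩ := h
    rw [Nat.le_div_iff_mul_le h1] at h4
    exact ⟨⟨Nat.mul_pos h1 h3, by rw [mul_comm]; exact h4⟩, h5, Dvd.intro_left _ rfl, (Nat.mul_pos h1 h3).ne'⟩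
  · rintro ⟨n, p⟩ h
    simp only [Finset.mem_sigma, Finset.mem_Icc, Nat.mem_primeFactors] at h
    simp [Nat.div_mul_cancel h.2.2.1]
  · rintro ⟨m, p⟩ h
    simp only [Finset.mem_sigma, Finset.mem_Icc, Finset.mem_filter] at h
    simp [Nat.mul_div_cancel _ h.2.2.pos]
  · rintro ⟨n, p⟩ h
    rfl

lemma hB_log {X : ℕ → ℝ} {n : ℕ} (hn : 1 ≤ n) :
    hB X n * Real.log n = ∑ p ∈ n.primeFactors, Real.log p * hB X (p * (n / p)) := by
  have h1 : ∀ p ∈ n.primeFactors, Real.log p * hB X (p * (n / p)) = Real.log p * hB X n := by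
    intro p hp
    rw [Nat.mul_div_cancel' (Nat.dvd_of_mem_primeFactors hp)]
  rw [Finset.sum_congr rfl h1, ← Finset.sum_mul, mul_comm]
  by_cases hs : Squarefree n
  · congr 1
    conv_lhs => rw [← Nat.prod_primeFactors_of_squarefree hs]
    rw [Nat.cast_prod, Real.log_prod]
    intro p hp
    exact_mod_cast (Nat.prime_of_mem_primeFactors hp).ne_zero
  · simp [hB, fB_eq_zero hs]

lemma sum_hB_log {X : ℕ → ℝ} (hX : ∀ m n, X (m*n) = X m * X n) (x : ℝ) :
    ∑ n ∈ Finset.Icc 1 ⌊x⌋₊, hB X n * Real.log n =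
    ∑ m ∈ Finset.Icc 1 ⌊x⌋₊, hB X m * ThB X (x / m) - DfB X x := by
  have h1 : ∀ n ∈ Finset.Icc 1 ⌊x⌋₊, hB X n * Real.log n =
     ∑ p ∈ n.primeFactors, Real.log p * hB X (p * (n / p)) :=
    fun n hn => hB_log (Finset.mem_Icc.mp hn).1
  rw [Finset.sum_congr rfl h1, hyperbola (fun p m => Real.log p * hB X (p * m))]
  unfold DfB ThB
  rw [← Finset.sum_sub_distrib]
  refine Finset.sum_congr rfl fun m hm => ?_
  rw [Nat.floor_div_natCast, Finset.mul_sum, ← Finset.sum_sub_distrib]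
  refine Finset.sum_congr rfl fun p hp => ?_
  by_cases hpp : p.Prime
  · simp only [hpp, if_true]
    unfold hB
    rw [fB_prime_mul hpp, hX]
    split_ifs <;> ring
  · simp [hpp]

lemma DfB_le {X : ℕ → ℝ} (hX1 : ∀ n, |X n| ≤ 1) (x : ℝ) :
    |DfB X x| ≤ ∑ p ∈ Finset.Icc 1 ⌊x⌋₊, if p.Prime then Real.log p * SB (x / (p:ℝ)^2) else 0 := by
  have h1 : |DfB X x| ≤ ∑ m ∈ Finset.Icc 1 ⌊x⌋₊, ∑ p ∈ Finset.Icc 1 (⌊x⌋₊ / m),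
    if p.Prime then (if p ∣ m then Real.log p * fB m else 0) else 0 := by
    unfold DfB
    refine (Finset.abs_sum_le_sum_abs _ _).trans (Finset.sum_le_sum fun m hm => ?_)
    rw [Nat.floor_div_natCast]
    refine (Finset.abs_sum_le_sum_abs _ _).trans (Finset.sum_le_sum fun p hp => ?_)
    split_ifs with h2 h3
    · have hl : 0 ≤ Real.log p := Real.log_natCast_nonneg p
      rw [abs_mul, abs_of_nonneg hl, abs_mul]
      have := abs_hB_le hX1 p
      have := abs_hB_le hX1 m
      have := fB_le_one p
      have := fB_nonneg m
      have : |hB X p| * |hB X m| ≤ 1 * fB m := by gcongr; linarith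
      gcongr; linarith
    · simp
    · simp
  refine h1.trans ?_
  have h2 : ∑ m ∈ Finset.Icc 1 ⌊x⌋₊, ∑ p ∈ Finset.Icc 1 (⌊x⌋₊ / m),
    (if p.Prime then (if p ∣ m then Real.log p * fB m else 0) else 0) =
    ∑ p ∈ Finset.Icc 1 ⌊x⌋₊, ∑ m ∈ Finset.Icc 1 (⌊x⌋₊ / p),
    (if p.Prime then (if p ∣ m then Real.log p * fB m else 0) else 0) := by
    apply Finset.sum_comm'
    intro m p
    simp only [Finset.mem_Icc]
    constructor
    · rintro ⟨⟨a, b⟩, c, d⟩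
      rw [Nat.le_div_iff_mul_le a] at d
      refine ⟨⟨a, ?_⟩, c, ?_⟩
      · rw [Nat.le_div_iff_mul_le c, mul_comm]; exact d
      · nlinarith
    · rintro ⟨⟨a, b⟩, c, d⟩
      rw [Nat.le_div_iff_mul_le c] at b
      refine ⟨⟨a, ?_⟩, c, ?_⟩
      · nlinarith
      · rw [Nat.le_div_iff_mul_le a, mul_comm]; exact b
  rw [h2]
  refine Finset.sum_le_sum fun p hp => ?_
  by_cases hpp : p.Prime
  · simp only [hpp, if_true]
    have hl : 0 ≤ Real.log p := Real.log_natCast_nonneg p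
    have h3 : ∑ m ∈ Finset.Icc 1 (⌊x⌋₊ / p), (if p ∣ m then Real.log p * fB m else 0) =
       Real.log p * ∑ k ∈ Finset.Icc 1 (⌊x⌋₊ / p / p), fB (p * k) := by
      rw [← Finset.sum_filter, ← Finset.mul_sum]
      congr 1
      symm
      refine Finset.sum_bij (fun k _ => p * k) ?_ ?_ ?_ ?_
      · intro k hk
        simp only [Finset.mem_Icc, Finset.mem_filter] at hk ⊢
        obtain ⟨a, b⟩ := hk
        rw [Nat.le_div_iff_mul_le hpp.pos, mul_comm] at b
        exact ⟨⟨Nat.mul_pos hpp.pos a, b⟩, Dvd.intro _ rfl⟩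
      · intro a _ b _ h
        exact Nat.eq_of_mul_eq_mul_left hpp.pos h
      · intro m hm
        simp only [Finset.mem_Icc, Finset.mem_filter] at hm
        obtain ⟨⟨a, b⟩, k, rfl⟩ := hm
        refine ⟨k, ?_, rfl⟩
        simp only [Finset.mem_Icc]
        refine ⟨?_, ?_⟩
        · rcases Nat.eq_zero_or_pos k with h | h
          · subst h; simp at a
          · exact h
        · rw [Nat.le_div_iff_mul_le hpp.pos, mul_comm]; exact b
      · intro _ _; rfl
    rw [h3]
    gcongr
    unfold SB
    have : ⌊x / (p:ℝ)^2⌋₊ = ⌊x⌋₊ / p / p := by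
      rw [pow_two, ← div_div, Nat.floor_div_natCast, Nat.floor_div_natCast]
    rw [this]
    exact Finset.sum_le_sum fun k _ => fB_prime_mul_le hpp
  · simp [hpp]

end PartB1

section PartB2

lemma SB_nonneg (x : ℝ) : 0 ≤ SB x := Finset.sum_nonneg fun n _ => fB_nonneg n

lemma SB_eq_zero {x : ℝ} (hx : x < 1) : SB x = 0 := by
  unfold SB
  rw [Nat.floor_eq_zero.mpr hx]; simp

lemma SB_le {x : ℝ} (hx : 0 ≤ x) : SB x ≤ x := by
  unfold SB
  calc _ ≤ ∑ n ∈ Finset.Icc 1 ⌊x⌋₊, (1:ℝ) := Finset.sum_le_sum fun n _ => fB_le_one n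
    _ = (⌊x⌋₊ : ℝ) := by simp
    _ ≤ x := Nat.floor_le hx

lemma abs_TB_le {X : ℕ → ℝ} (hX1 : ∀ n, |X n| ≤ 1) (x : ℝ) : |TB X x| ≤ SB x :=
  (Finset.abs_sum_le_sum_abs _ _).trans (Finset.sum_le_sum fun n _ => abs_hB_le hX1 n)

lemma log_sum_summable : Summable fun n : ℕ => Real.log n * (1 + 2 * Real.log n) / (n:ℝ)^2 := by
  have hs : Summable fun n : ℕ => 36 * (1 / (n:ℝ)^(3/2:ℝ)) :=
    (Real.summable_one_div_nat_rpow.mpr (by norm_num)).mul_left 36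
  refine Summable.of_nonneg_of_le (fun n => ?_) (fun n => ?_) hs
  · have := Real.log_natCast_nonneg n
    positivity
  · rcases Nat.eq_zero_or_pos n with h | h
    · subst h; simp
    have hn : (1:ℝ) ≤ n := by exact_mod_cast h
    have h1 : Real.log n ≤ 4 * (n:ℝ)^(1/4:ℝ) := by
      have := Real.log_le_rpow_div (show (0:ℝ) ≤ n by linarith) (show (0:ℝ) < 1/4 by norm_num)
      linarith
    have h2 : (1:ℝ) ≤ (n:ℝ)^(1/4:ℝ) := Real.one_le_rpow hn (by norm_num)
    have h0 := Real.log_natCast_nonneg n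
    have h3 : (n:ℝ)^(1/4:ℝ) * (n:ℝ)^(1/4:ℝ) * (n:ℝ)^(3/2:ℝ) = (n:ℝ)^2 := by
      rw [← Real.rpow_add (by linarith), ← Real.rpow_add (by linarith), ← Real.rpow_natCast]
      norm_num
    have h4 : 0 < (n:ℝ)^(3/2:ℝ) := by positivity
    rw [← h3, mul_one_div, div_le_div_iff₀ (by positivity) h4]
    set q := (n:ℝ)^(1/4:ℝ)
    have : Real.log n * (1 + 2 * Real.log n) ≤ 36 * (q*q) := by nlinarith
    nlinarith

lemma rpow_neg_submul {a b c β : ℝ} (ha : 1 ≤ a) (hb : 1 ≤ b) (hc : 0 < c) (h : c ≤ a * b) (hβ : 0 ≤ β)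
    (hβ1 : β ≤ 1) : a^(-β) ≤ c^(-β) * b := by
  have h1 : c^β ≤ a^β * b := by
    calc c^β ≤ (a*b)^β := Real.rpow_le_rpow hc.le h hβ
      _ = a^β * b^β := Real.mul_rpow (by linarith) (by linarith)
      _ ≤ a^β * b^(1:ℝ) := by gcongr
      _ = _ := by rw [Real.rpow_one]
  rw [Real.rpow_neg (by linarith), Real.rpow_neg (by linarith), inv_mul_eq_div, le_div_iff₀ (by positivity),
    inv_mul_le_iff₀ (by positivity)]
  exact h1

lemma DfB_bound : ∃ C : ℝ, 0 < C ∧ ∀ X : ℕ → ℝ, (∀ n, |X n| ≤ 1) → ∀ A β : ℝ, 0 ≤ A → 0 ≤ β → β ≤ 1 →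
    (∀ y, 1 ≤ y → SB y ≤ A * (y * (1 + Real.log y)^(-β))) → ∀ x, 1 ≤ x →
    |DfB X x| ≤ C * A * (x * (1 + Real.log x)^(-β)) := by
  set Z := ∑' n : ℕ, Real.log n * (1 + 2 * Real.log n) / (n:ℝ)^2 with hZ
  have hnn : ∀ n : ℕ, 0 ≤ Real.log n * (1 + 2 * Real.log n) / (n:ℝ)^2 := by
    intro n
    have := Real.log_natCast_nonneg n
    positivity
  have hZ0 : 0 ≤ Z := tsum_nonneg hnn
  refine ⟨Z + 1, by linarith, fun X hX1 A β hA hβ hβ1 hS x hx => ?_⟩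
  have hlx := Real.log_nonneg hx
  have hD : 0 ≤ A * (x * (1 + Real.log x)^(-β)) := by positivity
  refine (DfB_le hX1 x).trans ?_
  have h1 : ∀ p ∈ Finset.Icc 1 ⌊x⌋₊, (if p.Prime then Real.log p * SB (x / (p:ℝ)^2) else 0) ≤
      (A * (x * (1 + Real.log x)^(-β))) * (Real.log p * (1 + 2 * Real.log p) / (p:ℝ)^2) := by
    intro p hp
    have hl := Real.log_natCast_nonneg p
    have hp1 : (1:ℝ) ≤ p := by exact_mod_cast (Finset.mem_Icc.mp hp).1
    split_ifs with hpp
    · by_cases hlt : x / (p:ℝ)^2 < 1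
      · rw [SB_eq_zero hlt, mul_zero]; exact mul_nonneg hD (hnn p)
      push Not at hlt
      have h2 := hS _ hlt
      have h3 : Real.log (x / (p:ℝ)^2) = Real.log x - 2 * Real.log p := by
        rw [Real.log_div (by linarith) (by positivity), Real.log_pow]; norm_num
      have h4 : 0 ≤ Real.log (x / (p:ℝ)^2) := Real.log_nonneg hlt
      have h5 := rpow_neg_submul (a := 1 + Real.log (x / (p:ℝ)^2)) (b := 1 + 2 * Real.log p) (c := 1 + Real.log x)
        (by linarith) (by linarith) (by linarith) (by rw [h3] at h4 ⊢; nlinarith) hβ hβ1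
      calc Real.log p * SB (x / (p:ℝ)^2)
          ≤ Real.log p * (A * (x / (p:ℝ)^2 * ((1 + Real.log x)^(-β) * (1 + 2 * Real.log p)))) := by
            gcongr
            refine h2.trans ?_
            gcongr
        _ = _ := by ring
    · exact mul_nonneg hD (hnn p)
  refine (Finset.sum_le_sum h1).trans ?_
  rw [← Finset.mul_sum]
  have := log_sum_summable.sum_le_tsum (Finset.Icc 1 ⌊x⌋₊) (fun n _ => hnn n)
  calc _ ≤ A * (x * (1 + Real.log x)^(-β)) * Z := by gcongr
    _ ≤ _ := by nlinarith

lemma block_term {a b L β : ℝ} (ha : 1 ≤ a) (hb : 1 ≤ b) (hL : 0 < L) (h : L ≤ a + b) (hβ : 0 ≤ β) (hβ1 : β ≤ 1) :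
    a^(-(4/3):ℝ) * b^(-β) ≤ 2 * L^(-β) * (a^(-(4/3):ℝ) + b^(-(4/3):ℝ)) := by
  have e : ∀ c : ℝ, 0 < c → L/2 ≤ c → c^(-β) ≤ 2 * L^(-β) := by
    intro c hc h1
    have h2 : c^(-β) ≤ (L/2)^(-β) := Real.rpow_le_rpow_of_nonpos (by positivity) h1 (by linarith)
    have h3 : (L/2)^(-β) = L^(-β) * 2^β := by
      rw [Real.div_rpow hL.le (by norm_num), Real.rpow_neg (by norm_num : (0:ℝ) ≤ 2) β, div_inv_eq_mul]
    have h4 : (2:ℝ)^β ≤ 2^(1:ℝ) := Real.rpow_le_rpow_of_exponent_le (by norm_num) hβ1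
    rw [Real.rpow_one] at h4
    have h5 : 0 < L^(-β) := by positivity
    rw [h3] at h2
    nlinarith
  have pa : 0 < a^(-(4/3):ℝ) := by positivity
  have pb : 0 < b^(-(4/3):ℝ) := by positivity
  have pL : 0 < L^(-β) := by positivity
  rcases le_total a b with hab | hab
  · have := e b (by linarith) (by linarith)
    nlinarith
  · have h1 := e a (by linarith) (by linarith)
    have h2 : a^(-(4/3):ℝ) * b^(-β) ≤ a^(-β) * b^(-(4/3):ℝ) := by
      have e1 : a^(-(4/3):ℝ) = a^(-β) * a^(β - 4/3) := by
        rw [← Real.rpow_add (by linarith)]; congr 1; ring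
      have e2 : b^(-(4/3):ℝ) = b^(-β) * b^(β - 4/3) := by
        rw [← Real.rpow_add (by linarith)]; congr 1; ring
      have e3 : a^(β - 4/3) ≤ b^(β - 4/3) := Real.rpow_le_rpow_of_nonpos (by linarith) hab (by linarith)
      rw [e1, e2]
      calc _ = (a^(-β) * b^(-β)) * a^(β - 4/3) := by ring
        _ ≤ (a^(-β) * b^(-β)) * b^(β - 4/3) := by gcongr
        _ = _ := by ring
    nlinarith

lemma WB_bound : ∃ C : ℝ, 0 < C ∧ ∀ A β : ℝ, 0 ≤ A → 0 ≤ β → β ≤ 1 →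
    (∀ y, 1 ≤ y → SB y ≤ A * (y * (1 + Real.log y)^(-β))) → ∀ x, 1 ≤ x →
    ∑ m ∈ Finset.Icc 1 ⌊x⌋₊, fB m / m * (1 + Real.log (x/m))^(-(4/3):ℝ) ≤ C * A * (1 + Real.log x)^(-β) := by
  have hsum : Summable fun n : ℕ => ((1:ℝ) + n)^(-(4/3):ℝ) := by
    have h := (Real.summable_nat_rpow (p := -(4/3))).mpr (by norm_num)
    have h2 := (summable_nat_add_iff 1).mpr h
    refine h2.congr fun n => ?_
    push_cast; rw [add_comm]
  set Z := ∑' n : ℕ, ((1:ℝ) + n)^(-(4/3):ℝ) with hZ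
  have hnn : ∀ n : ℕ, 0 ≤ ((1:ℝ) + n)^(-(4/3):ℝ) := fun n => by positivity
  have hZ0 : 0 ≤ Z := tsum_nonneg hnn
  refine ⟨Real.exp 1 * (4 * (Z+1)), by positivity, fun A β hA hβ hβ1 hS x hx => ?_⟩
  have hlx := Real.log_nonneg hx
  set J := ⌊Real.log x⌋₊ with hJ
  have hJx : (J:ℝ) ≤ Real.log x := Nat.floor_le hlx
  have hmem : ∀ m ∈ Finset.Icc 1 ⌊x⌋₊, (1:ℝ) ≤ m ∧ (m:ℝ) ≤ x := by
    intro m hm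
    rw [Finset.mem_Icc] at hm
    exact ⟨by exact_mod_cast hm.1, (Nat.le_floor_iff (by linarith)).mp hm.2⟩
  have hmaps : ∀ m ∈ Finset.Icc 1 ⌊x⌋₊, ⌊Real.log (x/m)⌋₊ ∈ Finset.range (J+1) := by
    intro m hm
    obtain ⟨h1, h2⟩ := hmem m hm
    rw [Finset.mem_range, Nat.lt_succ_iff]
    apply Nat.floor_le_floor
    apply Real.log_le_log (by positivity)
    exact div_le_self (by linarith) h1
  rw [← Finset.sum_fiberwise_of_maps_to hmaps]
  have hfib : ∀ j ∈ Finset.range (J+1), ∑ m ∈ Finset.Icc 1 ⌊x⌋₊ with ⌊Real.log (x/(m:ℕ))⌋₊ = j,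
      fB m / m * (1 + Real.log (x/m))^(-(4/3):ℝ) ≤
      Real.exp 1 * A * (2 * (1 + Real.log x)^(-β)) * (((1:ℝ) + j)^(-(4/3):ℝ) + ((1:ℝ) + ((J - j : ℕ):ℝ))^(-(4/3):ℝ)) := by
    intro j hj
    have hjJ : j ≤ J := by rw [Finset.mem_range] at hj; omega
    have hjJ' : (j:ℝ) ≤ J := by exact_mod_cast hjJ
    have hy : 1 ≤ x / Real.exp j := by
      rw [le_div_iff₀ (Real.exp_pos _), one_mul, ← Real.le_log_iff_exp_le (by linarith)]
      linarith
    have hly : Real.log (x / Real.exp j) = Real.log x - j := by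
      rw [Real.log_div (by linarith) (Real.exp_pos _).ne', Real.log_exp]
    have hS1 := hS _ hy
    have h1 : ∑ m ∈ Finset.Icc 1 ⌊x⌋₊ with ⌊Real.log (x/(m:ℕ))⌋₊ = j, fB m / m * (1 + Real.log (x/m))^(-(4/3):ℝ) ≤
       ∑ m ∈ Finset.Icc 1 ⌊x⌋₊ with ⌊Real.log (x/(m:ℕ))⌋₊ = j, fB m * (Real.exp (j+1) / x * ((1:ℝ)+j)^(-(4/3):ℝ)) := by
      refine Finset.sum_le_sum fun m hm => ?_
      rw [Finset.mem_filter] at hm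
      obtain ⟨hm1, hm2⟩ := hm
      obtain ⟨h1, h2⟩ := hmem m hm1
      have hm0 : (0:ℝ) < m := by linarith
      have hl0 : 0 ≤ Real.log (x/m) := Real.log_nonneg (by rwa [le_div_iff₀ hm0, one_mul])
      have h3 : (j:ℝ) ≤ Real.log (x/m) := by rw [← hm2]; exact Nat.floor_le hl0
      have h4 : Real.log (x/m) < j + 1 := by rw [← hm2]; exact Nat.lt_floor_add_one _
      have h5 : x/m ≤ Real.exp (j+1) := by
        rw [← Real.log_le_iff_le_exp (by positivity)]; exact h4.le
      have h6 : 1/(m:ℝ) ≤ Real.exp (j+1) / x := by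
        rw [div_le_iff₀ hm0] at h5
        rw [div_le_div_iff₀ hm0 (by linarith)]; linarith
      have h7 : (1 + Real.log (x/m))^(-(4/3):ℝ) ≤ ((1:ℝ)+j)^(-(4/3):ℝ) :=
        Real.rpow_le_rpow_of_nonpos (by positivity) (by linarith) (by norm_num)
      have := fB_nonneg m
      rw [div_eq_mul_one_div, mul_assoc]
      gcongr
    refine h1.trans ?_
    rw [← Finset.sum_mul]
    have h2 : ∑ m ∈ Finset.Icc 1 ⌊x⌋₊ with ⌊Real.log (x/(m:ℕ))⌋₊ = j, fB m ≤ SB (x / Real.exp j) := by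
      unfold SB
      apply Finset.sum_le_sum_of_subset_of_nonneg
      · intro m hm
        rw [Finset.mem_filter] at hm
        obtain ⟨hm1, hm2⟩ := hm
        obtain ⟨h1, h2⟩ := hmem m hm1
        have hm0 : (0:ℝ) < m := by linarith
        have hl0 : 0 ≤ Real.log (x/m) := Real.log_nonneg (by rwa [le_div_iff₀ hm0, one_mul])
        have h3 : (j:ℝ) ≤ Real.log (x/m) := by rw [← hm2]; exact Nat.floor_le hl0
        rw [Real.le_log_iff_exp_le (by positivity)] at h3
        rw [Finset.mem_Icc]
        refine ⟨by exact_mod_cast h1, Nat.le_floor ?_⟩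
        rw [le_div_iff₀ hm0] at h3
        rw [le_div_iff₀ (Real.exp_pos _)]; linarith
      · intro m _ _; exact fB_nonneg m
    have h3 := block_term (a := 1 + (j:ℝ)) (b := 1 + Real.log (x / Real.exp j)) (L := 1 + Real.log x) (β := β)
      (by linarith [Nat.cast_nonneg (α := ℝ) j]) (by rw [hly]; linarith) (by linarith) (by rw [hly]; linarith) hβ hβ1
    have h4 : (1 + Real.log (x / Real.exp j))^(-(4/3):ℝ) ≤ ((1:ℝ) + ((J - j : ℕ):ℝ))^(-(4/3):ℝ) := by
      apply Real.rpow_le_rpow_of_nonpos (by positivity) _ (by norm_num)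
      rw [Nat.cast_sub hjJ, hly]; linarith
    have hx0 : x ≠ 0 := by linarith
    calc _ ≤ A * (x / Real.exp j * (1 + Real.log (x / Real.exp j))^(-β)) * (Real.exp (j+1) / x * ((1:ℝ)+j)^(-(4/3):ℝ)) := by
          gcongr; exact h2.trans hS1
      _ = Real.exp 1 * A * (((1:ℝ)+j)^(-(4/3):ℝ) * (1 + Real.log (x / Real.exp j))^(-β)) := by
          rw [Real.exp_add]; field_simp
      _ ≤ Real.exp 1 * A * (2 * (1 + Real.log x)^(-β) * (((1:ℝ)+j)^(-(4/3):ℝ) + (1 + Real.log (x / Real.exp j))^(-(4/3):ℝ))) := by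
          gcongr
      _ ≤ Real.exp 1 * A * (2 * (1 + Real.log x)^(-β) * (((1:ℝ)+j)^(-(4/3):ℝ) + ((1:ℝ) + ((J - j : ℕ):ℝ))^(-(4/3):ℝ))) := by
          gcongr
      _ = _ := by ring
  refine (Finset.sum_le_sum hfib).trans ?_
  rw [← Finset.mul_sum, Finset.sum_add_distrib]
  have hr := Finset.sum_range_reflect (fun i : ℕ => ((1:ℝ) + (i:ℝ))^(-(4/3):ℝ)) (J+1)
  simp only [Nat.add_sub_cancel] at hr
  have hr' : ∑ j ∈ Finset.range (J+1), ((1:ℝ) + ((J - j : ℕ):ℝ))^(-(4/3):ℝ) = ∑ j ∈ Finset.range (J+1), ((1:ℝ) + (j:ℝ))^(-(4/3):ℝ) := by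
    rw [← hr]
  rw [hr']
  have hle := hsum.sum_le_tsum (Finset.range (J+1)) (fun n _ => hnn n)
  calc _ ≤ Real.exp 1 * A * (2 * (1 + Real.log x)^(-β)) * ((Z+1) + (Z+1)) := by gcongr <;> linarith
    _ = _ := by ring

noncomputable def EB (X : ℕ → ℝ) (κ x : ℝ) : ℝ :=
  ∑ m ∈ Finset.Icc 1 ⌊x⌋₊, hB X m * (ThB X (x/m) - κ * (x/m))

lemma EB_bound : ∃ C : ℝ, 0 < C ∧ ∀ X : ℕ → ℝ, (∀ n, |X n| ≤ 1) → ∀ κ B : ℝ, 0 ≤ B →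
    (∀ y, 1 ≤ y → |ThB X y - κ * y| ≤ B * (y * (1 + Real.log y)^(-(4/3):ℝ))) → ∀ A β : ℝ, 0 ≤ A → 0 ≤ β → β ≤ 1 →
    (∀ y, 1 ≤ y → SB y ≤ A * (y * (1 + Real.log y)^(-β))) → ∀ x, 1 ≤ x →
    |EB X κ x| ≤ C * B * A * (x * (1 + Real.log x)^(-β)) := by
  obtain ⟨C, hC0, hC⟩ := WB_bound
  refine ⟨C, hC0, fun X hX1 κ B hB0 hB A β hA hβ hβ1 hS x hx => ?_⟩
  have h := hC A β hA hβ hβ1 hS x hx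
  have h1 : |EB X κ x| ≤ B * x * ∑ m ∈ Finset.Icc 1 ⌊x⌋₊, fB m / m * (1 + Real.log (x/m))^(-(4/3):ℝ) := by
    unfold EB
    refine (Finset.abs_sum_le_sum_abs _ _).trans ?_
    rw [Finset.mul_sum]
    refine Finset.sum_le_sum fun m hm => ?_
    rw [Finset.mem_Icc] at hm
    have hm1 : (1:ℝ) ≤ m := by exact_mod_cast hm.1
    have hm2 : (m:ℝ) ≤ x := (Nat.le_floor_iff (by linarith)).mp hm.2
    have h2 := hB (x/m) (by rwa [le_div_iff₀ (by linarith), one_mul])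
    have h3 := abs_hB_le hX1 m
    rw [abs_mul]
    have := fB_nonneg m
    calc _ ≤ fB m * (B * (x/m * (1 + Real.log (x/m))^(-(4/3):ℝ))) := by gcongr
      _ = _ := by ring
  refine h1.trans ?_
  calc _ ≤ B * x * (C * A * (1 + Real.log x)^(-β)) := by gcongr
    _ = _ := by ring

end PartB2

section PartB3

open MeasureTheory

lemma TB_eq (X : ℕ → ℝ) (x : ℝ) : TB X x = ∑ n ∈ Finset.Icc 0 ⌊x⌋₊, hB X n := by
  unfold TB
  rw [← Finset.add_sum_Ioc_eq_sum_Icc (Nat.zero_le _)]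
  simp [hB, fB_zero]
  rfl

lemma SB_eq_TB (x : ℝ) : SB x = TB (fun _ => 1) x := by
  simp [SB, TB, hB]

lemma sumIcc {c : ℕ → ℝ} (hc : c 0 = 0) (N : ℕ) : ∑ n ∈ Finset.Icc 1 N, c n = ∑ n ∈ Finset.Icc 0 N, c n := by
  rw [← Finset.add_sum_Ioc_eq_sum_Icc (Nat.zero_le _), hc, zero_add]
  rfl

lemma TB_int (X : ℕ → ℝ) {g : ℝ → ℝ} {a b : ℝ} (ha : 0 ≤ a) (hg : IntegrableOn g (Set.Icc a b)) :
    IntegrableOn (fun t => g t * TB X t) (Set.Icc a b) := by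
  have := integrableOn_mul_sum_Icc (m := 1) (c := hB X) ha hg
  exact this

lemma inv_int (x : ℝ) : IntegrableOn (fun t : ℝ => t⁻¹) (Set.Icc 1 x) := by
  apply ContinuousOn.integrableOn_Icc
  intro t ht
  exact (continuousAt_inv₀ (by linarith [ht.1])).continuousWithinAt

lemma abel_log (X : ℕ → ℝ) (x : ℝ) : ∑ n ∈ Finset.Icc 1 ⌊x⌋₊, hB X n * Real.log n =
    TB X x * Real.log x - ∫ t in Set.Ioc 1 x, t⁻¹ * TB X t := by
  have hd : ∀ t ∈ Set.Icc 1 x, DifferentiableAt ℝ Real.log t := fun t ht =>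
    Real.differentiableAt_log (by linarith [ht.1])
  have h := sum_mul_eq_sub_integral_mul₀ (hB X) (f := Real.log) (by simp [hB, fB_zero]) x
    hd (by rw [Real.deriv_log']; exact inv_int x)
  simp only [Real.deriv_log', ← TB_eq] at h
  rw [sumIcc (c := fun n => hB X n * Real.log n) (by simp), mul_comm (TB X x), ← h]
  exact Finset.sum_congr rfl fun n _ => mul_comm _ _

noncomputable def IB (x : ℝ) : ℝ := ∫ t in (1)..x, (t^2)⁻¹ * SB t

lemma inv_sq_int (x : ℝ) : IntegrableOn (fun t : ℝ => (t^2)⁻¹) (Set.Icc 1 x) := by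
  apply ContinuousOn.integrableOn_Icc
  intro t ht
  have : t ^ 2 ≠ 0 := by have := ht.1; positivity
  exact ((continuousAt_id.pow 2).inv₀ this).continuousWithinAt

lemma abel_inv {x : ℝ} (hx : 1 ≤ x) : ∑ n ∈ Finset.Icc 1 ⌊x⌋₊, fB n / n = SB x / x + IB x := by
  have hd : ∀ t ∈ Set.Icc 1 x, DifferentiableAt ℝ (fun t : ℝ => t⁻¹) t := fun t ht =>
    differentiableAt_inv (by linarith [ht.1])
  have h := sum_mul_eq_sub_integral_mul₀ (hB fun _ => 1) (f := fun t : ℝ => t⁻¹) (by simp [hB, fB_zero]) x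
    hd (by rw [deriv_inv']; exact (inv_sq_int x).neg)
  simp only [deriv_inv', ← TB_eq, ← SB_eq_TB] at h
  rw [sumIcc (c := fun n : ℕ => fB n / n) (by simp)]
  unfold IB
  rw [intervalIntegral.integral_of_le hx]
  simp only [neg_mul, integral_neg, sub_neg_eq_add] at h
  rw [div_eq_inv_mul, ← h]
  exact Finset.sum_congr rfl fun n _ => by simp [hB, div_eq_inv_mul]

lemma one_add_log_le {u : ℝ} (hu : 1 ≤ u) : 1 + Real.log u ≤ 2 * Real.sqrt u := by
  have h1 : 0 < Real.sqrt u := Real.sqrt_pos.mpr (by linarith)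
  have h2 := Real.log_le_sub_one_of_pos h1
  rw [Real.log_sqrt (by linarith)] at h2
  linarith

lemma JB_bound {X : ℕ → ℝ} (hX1 : ∀ n, |X n| ≤ 1) {A β : ℝ} (hA : 0 ≤ A) (hβ : 0 ≤ β) (hβ1 : β ≤ 1)
    (hS : ∀ y, 1 ≤ y → SB y ≤ A * (y * (1 + Real.log y)^(-β))) {x : ℝ} (hx : 1 ≤ x) :
    |∫ t in Set.Ioc 1 x, t⁻¹ * TB X t| ≤ 4 * A * (x * (1 + Real.log x)^(-β)) := by
  have hlx := Real.log_nonneg hx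
  set c := 2 * A * (1 + Real.log x)^(-β) * Real.sqrt x with hc
  have hc0 : 0 ≤ c := by positivity
  have hIntg : IntervalIntegrable (fun t : ℝ => c * t^(-(1/2):ℝ)) volume 1 x :=
    (intervalIntegral.intervalIntegrable_rpow' (by norm_num)).const_mul c
  have h1 : ‖∫ t in Set.Ioc 1 x, t⁻¹ * TB X t‖ ≤ ∫ t in Set.Ioc 1 x, c * t^(-(1/2):ℝ) := by
    refine norm_integral_le_of_norm_le ((intervalIntegrable_iff_integrableOn_Ioc_of_le hx).mp hIntg) ?_
    refine (ae_restrict_iff' measurableSet_Ioc).mpr (Filter.Eventually.of_forall fun t ht => ?_)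
    obtain ⟨ht1, ht2⟩ := ht
    have ht0 : 0 < t := by linarith
    rw [norm_mul, Real.norm_eq_abs, Real.norm_eq_abs, abs_of_pos (inv_pos.mpr ht0)]
    have h2 := (abs_TB_le hX1 t).trans (hS t ht1.le)
    have hlt := Real.log_nonneg ht1.le
    have hxt : 1 ≤ x/t := by rwa [le_div_iff₀ ht0, one_mul]
    have hlxt : Real.log (x/t) = Real.log x - Real.log t := Real.log_div (by linarith) ht0.ne'
    have h3 := rpow_neg_submul (a := 1 + Real.log t) (b := 1 + Real.log (x/t)) (c := 1 + Real.log x) (β := β)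
      (by linarith) (by linarith [Real.log_nonneg hxt]) (by linarith)
      (by have := Real.log_nonneg hxt; rw [hlxt] at this ⊢; nlinarith) hβ hβ1
    have h4 := one_add_log_le hxt
    have h5 : Real.sqrt (x/t) = Real.sqrt x * t^(-(1/2):ℝ) := by
      rw [Real.sqrt_div (by linarith), Real.rpow_neg ht0.le, ← Real.sqrt_eq_rpow, div_eq_mul_inv]
    calc t⁻¹ * |TB X t| ≤ t⁻¹ * (A * (t * ((1 + Real.log x)^(-β) * (2 * Real.sqrt (x/t))))) := by
          gcongr
          refine h2.trans ?_
          gcongr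
          refine h3.trans ?_
          gcongr
      _ = c * t^(-(1/2):ℝ) := by rw [h5, hc]; field_simp
  rw [Real.norm_eq_abs] at h1
  refine h1.trans ?_
  rw [← intervalIntegral.integral_of_le hx, intervalIntegral.integral_const_mul, integral_rpow (Or.inl (by norm_num))]
  have h6 : (-(1/2:ℝ) + 1) = 1/2 := by norm_num
  rw [h6, ← Real.sqrt_eq_rpow, Real.one_rpow]
  have h7 : Real.sqrt x * Real.sqrt x = x := Real.mul_self_sqrt (by linarith)
  have h8 := Real.sqrt_nonneg x
  calc c * ((Real.sqrt x - 1) / (1/2)) ≤ c * (2 * Real.sqrt x) := by gcongr; linarith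
    _ = 4 * A * ((Real.sqrt x * Real.sqrt x) * (1 + Real.log x)^(-β)) := by rw [hc]; ring
    _ = _ := by rw [h7]

lemma EB_eq (X : ℕ → ℝ) (κ x : ℝ) : EB X κ x = ∑ m ∈ Finset.Icc 1 ⌊x⌋₊, hB X m * ThB X (x / m) -
    κ * x * ∑ m ∈ Finset.Icc 1 ⌊x⌋₊, hB X m / m := by
  unfold EB
  rw [Finset.mul_sum, ← Finset.sum_sub_distrib]
  refine Finset.sum_congr rfl fun m _ => by ring

/-- Basic estimate. -/
lemma basic_est {X : ℕ → ℝ} (hX : ∀ m n, X (m*n) = X m * X n) (hX1 : ∀ n, |X n| ≤ 1) {κ B : ℝ} (hB0 : 0 ≤ B)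
    (hBd : ∀ y, 1 ≤ y → |ThB X y - κ * y| ≤ B * (y * (1 + Real.log y)^(-(4/3):ℝ))) :
    ∃ C : ℝ, 0 < C ∧ ∀ A β : ℝ, 0 ≤ A → 0 ≤ β → β ≤ 1 →
    (∀ y, 1 ≤ y → SB y ≤ A * (y * (1 + Real.log y)^(-β))) → ∀ x, 1 ≤ x →
    |TB X x * Real.log x - κ * x * ∑ m ∈ Finset.Icc 1 ⌊x⌋₊, hB X m / m| ≤ C * A * (x * (1 + Real.log x)^(-β)) := by
  obtain ⟨C1, hC10, hC1⟩ := DfB_bound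
  obtain ⟨C2, hC20, hC2⟩ := EB_bound
  refine ⟨C1 + C2 * B + 4, by positivity, fun A β hA hβ hβ1 hS x hx => ?_⟩
  have e1 := hC1 X hX1 A β hA hβ hβ1 hS x hx
  have e2 := hC2 X hX1 κ B hB0 hBd A β hA hβ hβ1 hS x hx
  have e3 := JB_bound hX1 hA hβ hβ1 hS hx
  have e4 := abel_log X x
  have e5 := sum_hB_log hX x
  have e6 := EB_eq X κ x
  have e7 : TB X x * Real.log x - κ * x * ∑ m ∈ Finset.Icc 1 ⌊x⌋₊, hB X m / m =
     (∫ t in Set.Ioc 1 x, t⁻¹ * TB X t) + EB X κ x - DfB X x := by linarith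
  rw [e7]
  refine (abs_sub _ _).trans ?_
  have := abs_add_le (∫ t in Set.Ioc 1 x, t⁻¹ * TB X t) (EB X κ x)
  linarith

end PartB3

section PartB4

open MeasureTheory Filter Topology

lemma SB_mono : Monotone SB := by
  intro x y h
  unfold SB
  apply Finset.sum_le_sum_of_subset_of_nonneg
  · exact Finset.Icc_subset_Icc le_rfl (Nat.floor_le_floor h)
  · intro n _ _; exact fB_nonneg n

lemma SB_int {a b : ℝ} (ha : 1 ≤ a) : IntegrableOn (fun t => (t^2)⁻¹ * SB t) (Set.Icc a b) := by
  have h := TB_int (fun _ => 1) (g := fun t : ℝ => (t^2)⁻¹) (a := a) (b := b) (by linarith)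
    ((inv_sq_int b).mono_set (Set.Icc_subset_Icc_left ha))
  simpa only [← SB_eq_TB] using h

lemma SB_right {x : ℝ} (hx : 0 ≤ x) : ∀ᶠ t in 𝓝[>] x, SB t = SB x := by
  have : Set.Ioo x (⌊x⌋₊ + 1 : ℝ) ∈ 𝓝[>] x := Ioo_mem_nhdsGT (Nat.lt_floor_add_one x)
  filter_upwards [this] with t ht
  unfold SB
  have : ⌊t⌋₊ = ⌊x⌋₊ := by
    rw [Nat.floor_eq_iff (by linarith [ht.1])]
    exact ⟨(Nat.floor_le hx).trans ht.1.le, ht.2⟩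
  rw [this]

lemma IB_deriv {x : ℝ} (hx : 1 ≤ x) : HasDerivWithinAt IB ((x^2)⁻¹ * SB x) (Set.Ici x) x := by
  unfold IB
  refine intervalIntegral.integral_hasDerivWithinAt_right (s := Set.Ici x) (t := Set.Ioi x)
    (f := fun t => (t^2)⁻¹ * SB t) ?_ ?_ ?_
  · rw [intervalIntegrable_iff_integrableOn_Icc_of_le hx]
    exact SB_int le_rfl
  · have hm : Measurable fun t : ℝ => (t^2)⁻¹ * SB t :=
      ((measurable_id.pow_const 2).inv).mul SB_mono.measurable
    exact hm.stronglyMeasurable.stronglyMeasurableAtFilter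
  · have h1 : ContinuousWithinAt SB (Set.Ioi x) x :=
      tendsto_const_nhds.congr' ((SB_right (by linarith)).mono fun t h => h.symm)
    have h2 : x^2 ≠ 0 := by positivity
    exact (((continuousAt_id.pow 2).inv₀ h2).continuousWithinAt).mul h1

lemma IB_cont {x y : ℝ} (hy : 1 ≤ y) (hx : y ≤ x) : ContinuousOn IB (Set.Icc y x) := by
  have h := intervalIntegral.continuousOn_primitive_interval (f := fun t => (t^2)⁻¹ * SB t) (a := 1) (b := x)
    (μ := volume) (by rw [Set.uIcc_of_le (hy.trans hx)]; exact SB_int le_rfl)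
  rw [Set.uIcc_of_le (hy.trans hx)] at h
  exact h.mono (Set.Icc_subset_Icc_left hy)

lemma IB_nonneg {x : ℝ} (hx : 1 ≤ x) : 0 ≤ IB x := by
  unfold IB
  apply intervalIntegral.integral_nonneg hx
  intro t ht
  exact mul_nonneg (by positivity) (SB_nonneg t)

noncomputable def GB (x : ℝ) : ℝ := IB x * Real.log x ^ (-(1/2):ℝ)

lemma GB_diff {K β : ℝ} (hK : 0 ≤ K) (hβ : 0 ≤ β)
    (hR : ∀ x, 1 ≤ x → |SB x * Real.log x - x/2 * IB x| ≤ K * (x * (1 + Real.log x)^(-β))) {x y : ℝ}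
    (hy : 1 < y) (hx : y ≤ x) : |GB x - GB y| ≤ 2 * K * Real.log y ^ (-(β+1/2)) := by
  have key : ‖GB x - GB y‖ ≤ 2 * K * (Real.log y ^ (-(β+1/2)) - Real.log x ^ (-(β+1/2))) := by
    refine image_norm_le_of_norm_deriv_right_le_deriv_boundary' (a := y) (b := x)
      (f := fun t => GB t - GB y)
      (f' := fun t => (t^2)⁻¹ * SB t * Real.log t ^ (-(1/2):ℝ) + IB t * ((-(1/2)) * Real.log t ^ (-(1/2)-1:ℝ) * t⁻¹))
      (B := fun t => 2 * K * (Real.log y ^ (-(β+1/2)) - Real.log t ^ (-(β+1/2))))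
      (B' := fun t => 2 * K * (0 - (-(β+1/2)) * Real.log t ^ (-(β+1/2)-1) * t⁻¹))
      ?_ ?_ ?_ ?_ ?_ ?_ ⟨hx, le_rfl⟩
    · refine ContinuousOn.sub (ContinuousOn.mul (IB_cont hy.le hx) ?_) continuousOn_const
      intro t ht
      have ht1 : 1 < t := hy.trans_le ht.1
      exact ((Real.continuousAt_log (by linarith)).rpow_const (Or.inl (Real.log_pos ht1).ne')).continuousWithinAt
    · intro t ht
      have ht1 : 1 < t := hy.trans_le ht.1
      have h1 := IB_deriv ht1.le
      have h2 : HasDerivAt (fun t : ℝ => Real.log t ^ (-(1/2):ℝ)) ((-(1/2)) * Real.log t ^ (-(1/2)-1:ℝ) * t⁻¹) t := by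
        have := (Real.hasDerivAt_log (show t ≠ 0 by linarith)).rpow_const (p := -(1/2)) (Or.inl (Real.log_pos ht1).ne')
        convert this using 1; ring
      exact (h1.mul h2.hasDerivWithinAt).sub_const _
    · simp
    · intro t ht
      have ht1 : 1 < t := hy.trans_le ht.1
      exact (continuousAt_const.mul (continuousAt_const.sub
        ((Real.continuousAt_log (by linarith)).rpow_const (Or.inl (Real.log_pos ht1).ne')))).continuousWithinAt
    · intro t ht
      have ht1 : 1 < t := hy.trans_le ht.1
      have h2 : HasDerivAt (fun t : ℝ => Real.log t ^ (-(β+1/2):ℝ)) ((-(β+1/2)) * Real.log t ^ (-(β+1/2)-1:ℝ) * t⁻¹) t := by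
        have := (Real.hasDerivAt_log (show t ≠ 0 by linarith)).rpow_const (p := -(β+1/2)) (Or.inl (Real.log_pos ht1).ne')
        convert this using 1; ring
      exact (((hasDerivAt_const t _).sub h2).const_mul _).hasDerivWithinAt
    · intro t ht
      have ht1 : 1 < t := hy.trans_le ht.1
      have hl := Real.log_pos ht1
      have ht0 : 0 < t := by linarith
      set l := Real.log t with hld
      have e1 : l ^ (-(1/2):ℝ) = l * l ^ (-(3/2):ℝ) := by
        nth_rewrite 2 [← Real.rpow_one l]
        rw [← Real.rpow_add hl]; norm_num
      have e2 : (-(1/2)-1:ℝ) = -(3/2) := by norm_num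
      have e3 : l ^ (-(β+1/2)-1) = l ^ (-(3/2):ℝ) * l ^ (-β) := by
        rw [← Real.rpow_add hl]; congr 1; ring
      have h1 := hR t ht1.le
      have h2 : (1 + l) ^ (-β) ≤ l ^ (-β) := Real.rpow_le_rpow_of_nonpos hl (by linarith) (by linarith)
      have h3 : (t^2)⁻¹ * SB t * l ^ (-(1/2):ℝ) + IB t * ((-(1/2)) * l ^ (-(1/2)-1:ℝ) * t⁻¹) =
         l ^ (-(3/2):ℝ) * (t^2)⁻¹ * (SB t * l - t/2 * IB t) := by
        rw [e1, e2]; field_simp; ring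
      rw [h3, Real.norm_eq_abs, abs_mul, abs_of_pos (by positivity), e3]
      calc _ ≤ l ^ (-(3/2):ℝ) * (t^2)⁻¹ * (K * (t * l^(-β))) := by
            gcongr; exact h1.trans (by gcongr)
        _ = K * (l ^ (-(3/2):ℝ) * l ^ (-β) * t⁻¹) * 1 := by field_simp
        _ ≤ K * (l ^ (-(3/2):ℝ) * l ^ (-β) * t⁻¹) * (2 * (β+1/2)) := by gcongr; linarith
        _ = _ := by ring
  rw [Real.norm_eq_abs] at key
  refine key.trans ?_
  have hlx : 0 < Real.log x := Real.log_pos (hy.trans_le hx)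
  have : 0 ≤ Real.log x ^ (-(β+1/2)) := by positivity
  have : 0 ≤ 2 * K := by linarith
  gcongr; linarith

lemma thB_one (y : ℝ) : ThB (fun _ => 1) y = thA 1 y + thA 7 y := by
  unfold ThB thA
  rw [← Finset.sum_add_distrib]
  refine Finset.sum_congr rfl fun p _ => ?_
  by_cases hp : p.Prime
  · have h1 : ((p:ZMod 8) = 1) ↔ p % 8 = 1 := by
      have := ZMod.natCast_eq_natCast_iff' p 1 8; simpa using this
    have h7 : ((p:ZMod 8) = 7) ↔ p % 8 = 7 := by
      have := ZMod.natCast_eq_natCast_iff' p 7 8; simpa using this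
    simp only [hp, true_and, if_true, hB, fB_prime hp, h1, h7, mul_one]
    by_cases a : p % 8 = 1
    · simp [a]
    · by_cases b : p % 8 = 7 <;> simp [a, b]
  · simp [hp]

noncomputable def chiB (n : ℕ) : ℝ := ((ZMod.χ₄ (n : ZMod 4) : ℤ) : ℝ)

lemma thB_chi (y : ℝ) : ThB chiB y = thA 1 y - thA 7 y := by
  unfold ThB thA
  rw [← Finset.sum_sub_distrib]
  refine Finset.sum_congr rfl fun p _ => ?_
  by_cases hp : p.Prime
  · have h1 : ((p:ZMod 8) = 1) ↔ p % 8 = 1 := by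
      have := ZMod.natCast_eq_natCast_iff' p 1 8; simpa using this
    have h7 : ((p:ZMod 8) = 7) ↔ p % 8 = 7 := by
      have := ZMod.natCast_eq_natCast_iff' p 7 8; simpa using this
    simp only [hp, true_and, if_true, hB, fB_prime hp, h1, h7]
    by_cases a : p % 8 = 1
    · have : chiB p = 1 := by
        unfold chiB; rw [ZMod.χ₄_nat_one_mod_four (by omega)]; simp
      simp [a, this]
    · by_cases b : p % 8 = 7
      · have : chiB p = -1 := by
          unfold chiB; rw [ZMod.χ₄_nat_three_mod_four (by omega)]; simp
        simp [b, this]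
      · simp [a, b]
  · simp [hp]

lemma chiB_mul (m n : ℕ) : chiB (m * n) = chiB m * chiB n := by
  unfold chiB; push_cast; rw [map_mul]; push_cast; ring

lemma chiB_le (n : ℕ) : |chiB n| ≤ 1 := by
  unfold chiB
  rcases ZMod.isQuadratic_χ₄ (n : ZMod 4) with h | h | h <;> rw [h] <;> simp

lemma thB_bounds : ∃ B : ℝ, 0 < B ∧
   (∀ y, 1 ≤ y → |ThB (fun _ => 1) y - 1/2 * y| ≤ B * (y * (1 + Real.log y)^(-(4/3):ℝ))) ∧
   (∀ y, 1 ≤ y → |ThB chiB y - 0 * y| ≤ B * (y * (1 + Real.log y)^(-(4/3):ℝ))) := by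
  obtain ⟨C1, h1, H1⟩ := thA_bound (a := 1) isUnit_one
  obtain ⟨C7, h7, H7⟩ := thA_bound (a := 7) (by decide)
  refine ⟨C1 + C7, by positivity, fun y hy => ?_, fun y hy => ?_⟩
  · have a := H1 y hy
    have b := H7 y hy
    rw [thB_one]
    have e : thA 1 y + thA 7 y - 1/2*y = (thA 1 y - y/4) + (thA 7 y - y/4) := by ring
    rw [e]
    refine (abs_add_le _ _).trans ?_
    linarith
  · have a := H1 y hy
    have b := H7 y hy
    rw [thB_chi]
    have e : thA 1 y - thA 7 y - 0*y = (thA 1 y - y/4) - (thA 7 y - y/4) := by ring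
    rw [e]
    refine (abs_sub _ _).trans ?_
    linarith

lemma SB_basic : ∃ C : ℝ, 0 < C ∧ ∀ A β : ℝ, 0 ≤ A → 0 ≤ β → β ≤ 1 →
    (∀ y, 1 ≤ y → SB y ≤ A * (y * (1 + Real.log y)^(-β))) → ∀ x, 1 ≤ x →
    |SB x * Real.log x - x/2 * IB x| ≤ C * A * (x * (1 + Real.log x)^(-β)) := by
  obtain ⟨B, hB0, hB1, -⟩ := thB_bounds
  obtain ⟨C, hC0, hC⟩ := basic_est (X := fun _ => 1) (by simp) (by simp) hB0.le hB1
  refine ⟨C + 1, by linarith, fun A β hA hβ hβ1 hS x hx => ?_⟩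
  have h := hC A β hA hβ hβ1 hS x hx
  rw [← SB_eq_TB] at h
  have e : ∑ m ∈ Finset.Icc 1 ⌊x⌋₊, hB (fun _ => 1) m / m = SB x / x + IB x := by
    rw [← abel_inv hx]; simp [hB]
  rw [e] at h
  have h2 := hS x hx
  have h3 := SB_nonneg x
  have hx0 : x ≠ 0 := by linarith
  have e2 : SB x * Real.log x - x/2 * IB x = (SB x * Real.log x - 1/2 * x * (SB x / x + IB x)) + SB x / 2 := by
    field_simp; ring
  rw [e2]
  refine (abs_add_le _ _).trans ?_
  rw [abs_of_nonneg (show 0 ≤ SB x / 2 by linarith)]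
  linarith

lemma SB_half : ∃ A : ℝ, 0 < A ∧ ∀ y, 1 ≤ y → SB y ≤ A * (y * (1 + Real.log y)^(-(1/2):ℝ)) := by
  obtain ⟨K, hK0, hK⟩ := SB_basic
  have hR := hK 1 0 (by norm_num) le_rfl (by norm_num) (by
    intro y hy
    simp only [neg_zero, Real.rpow_zero, mul_one, one_mul]
    exact SB_le (by linarith))
  have he : (1:ℝ) < Real.exp 1 := by rw [Real.one_lt_exp_iff]; norm_num
  set M := |GB (Real.exp 1)| + 2 * K with hM
  have hM0 : 0 ≤ M := by positivity
  refine ⟨2 * (M + K + 1), by positivity, fun y hy => ?_⟩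
  have hl := Real.log_nonneg hy
  rcases le_total (Real.exp 1) y with h | h
  · have hd := GB_diff (K := K * 1) (by linarith) le_rfl hR he h
    rw [Real.log_exp, Real.one_rpow] at hd
    have hG : |GB y| ≤ M := by
      have := abs_sub_abs_le_abs_sub (GB y) (GB (Real.exp 1))
      rw [hM]; linarith
    have hl1 : 1 ≤ Real.log y := by rwa [Real.le_log_iff_exp_le (by linarith)]
    set l := Real.log y with hld
    have hl0 : 0 < l := by linarith
    have e1 : IB y = GB y * l^(1/2:ℝ) := by
      unfold GB
      rw [mul_assoc, ← hld, ← Real.rpow_add hl0]; norm_num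
    have h2 := hR y hy
    simp only [neg_zero, Real.rpow_zero, mul_one] at h2
    rw [← hld] at h2
    have h3 : SB y * l ≤ y/2 * IB y + K * y := by
      have := (abs_le.mp h2).2; linarith
    have h4 : IB y ≤ M * l^(1/2:ℝ) := by
      rw [e1]; gcongr; exact (le_abs_self _).trans hG
    have h5 : 1 ≤ l^(1/2:ℝ) := Real.one_le_rpow hl1 (by norm_num)
    have h6 : SB y * l ≤ (M + K) * y * l^(1/2:ℝ) := by
      have a1 : y/2 * IB y ≤ y/2 * (M * l^(1/2:ℝ)) := by gcongr
      have a2 : K * y * 1 ≤ K * y * l^(1/2:ℝ) := by gcongr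
      have a3 : 0 ≤ y * (M * l^(1/2:ℝ)) := by positivity
      linarith
    have h7 : SB y ≤ (M+K) * (y * l^(-(1/2):ℝ)) := by
      have e2 : l^(1/2:ℝ) = l * l^(-(1/2):ℝ) := by
        nth_rewrite 2 [← Real.rpow_one l]
        rw [← Real.rpow_add hl0]; norm_num
      rw [e2] at h6
      refine le_of_mul_le_mul_right (h6.trans (le_of_eq ?_)) hl0
      ring
    have h8 := rpow_neg_submul (a := l) (b := 2) (c := 1 + l) (β := 1/2) hl1 (by norm_num) (by linarith)
      (by linarith) (by norm_num) (by norm_num)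
    refine h7.trans ?_
    calc _ ≤ (M + K) * (y * ((1+l)^(-(1/2):ℝ) * 2)) := by gcongr
      _ ≤ (M + K + 1) * (y * ((1+l)^(-(1/2):ℝ) * 2)) := mul_le_mul_of_nonneg_right (by linarith) (by positivity)
      _ = _ := by ring
  · have hl1 : Real.log y ≤ 1 := by rwa [Real.log_le_iff_le_exp (by linarith)]
    have h8 := rpow_neg_submul (a := 1) (b := 2) (c := 1 + Real.log y) (β := 1/2) le_rfl (by norm_num) (by linarith)
      (by linarith) (by norm_num) (by norm_num)
    rw [Real.one_rpow] at h8
    refine (SB_le (by linarith)).trans ?_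
    have : 0 ≤ y * (1 + Real.log y)^(-(1/2):ℝ) := by positivity
    nlinarith

lemma SB_asymp : ∃ c C : ℝ, 0 < C ∧ ∀ x, Real.exp 1 ≤ x →
    |SB x - c * (x * Real.log x ^ (-(1/2):ℝ))| ≤ C * (x * Real.log x ^ (-(3/2):ℝ)) := by
  obtain ⟨A, hA0, hA⟩ := SB_half
  obtain ⟨K', hK0', hK'⟩ := SB_basic
  have hR := hK' A (1/2) hA0.le (by norm_num) (by norm_num) hA
  set K := K' * A with hKd
  have hK0 : 0 < K := by positivity
  have he : (1:ℝ) < Real.exp 1 := by rw [Real.one_lt_exp_iff]; norm_num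
  have hd : ∀ y x, Real.exp 1 ≤ y → y ≤ x → |GB x - GB y| ≤ 2 * K * Real.log y ^ (-1:ℝ) := by
    intro y x hy hx
    have := GB_diff hK0.le (by norm_num) hR (he.trans_le hy) hx
    norm_num at this
    exact this
  have hcau : CauchySeq GB := by
    rw [Metric.cauchySeq_iff']
    intro ε hε
    refine ⟨Real.exp (max 1 (4 * K / ε)), fun x hx => ?_⟩
    have h1 := hd _ x (Real.exp_le_exp.mpr (le_max_left _ _)) hx
    rw [Real.dist_eq]
    refine h1.trans_lt ?_
    rw [Real.log_exp, Real.rpow_neg_one]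
    have hm : 0 < max 1 (4*K/ε) := lt_max_of_lt_left one_pos
    rw [← div_eq_mul_inv, div_lt_iff₀ hm]
    have h2 := le_max_right 1 (4*K/ε)
    rw [div_le_iff₀ hε] at h2
    linarith
  obtain ⟨g, hg⟩ := cauchySeq_tendsto_of_complete hcau
  refine ⟨g/2, 2*K, by positivity, fun x hx => ?_⟩
  have hgx : |g - GB x| ≤ 2 * K * Real.log x ^ (-1:ℝ) := by
    refine le_of_tendsto ((hg.sub_const (GB x)).abs) ?_
    filter_upwards [eventually_ge_atTop x] with z hz
    exact hd x z hx hz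
  have hx1 : 1 ≤ x := he.le.trans hx
  have hl1 : 1 ≤ Real.log x := by rwa [Real.le_log_iff_exp_le (by linarith)]
  have hr := hR x hx1
  set l := Real.log x with hld
  have hl0 : 0 < l := by linarith
  have e1 : IB x = GB x * l^(1/2:ℝ) := by
    unfold GB
    rw [mul_assoc, ← hld, ← Real.rpow_add hl0]; norm_num
  have e2 : l^(1/2:ℝ) = l * l^(-(1/2):ℝ) := by
    nth_rewrite 2 [← Real.rpow_one l]
    rw [← Real.rpow_add hl0]; norm_num
  have e3 : l^(-(1/2):ℝ) = l * l^(-(3/2):ℝ) := by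
    nth_rewrite 2 [← Real.rpow_one l]
    rw [← Real.rpow_add hl0]; norm_num
  have e4 : l^(-1:ℝ) * l = 1 := by rw [Real.rpow_neg_one]; field_simp
  have h2 : (1+l)^(-(1/2):ℝ) ≤ l^(-(1/2):ℝ) := Real.rpow_le_rpow_of_nonpos hl0 (by linarith) (by norm_num)
  have e5 : (SB x - g/2 * (x * l^(-(1/2):ℝ))) * l = (SB x * l - x/2 * IB x) - x/2 * (l * l^(-(1/2):ℝ)) * (g - GB x) := by
    rw [e1, e2]; ring
  have h3 : |(SB x - g/2 * (x * l^(-(1/2):ℝ))) * l| ≤ (2 * K * (x * l^(-(3/2):ℝ))) * l := by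
    rw [e5]
    refine (abs_sub _ _).trans ?_
    rw [abs_mul (x/2 * _), abs_of_nonneg (show 0 ≤ x/2 * (l * l^(-(1/2):ℝ)) by positivity)]
    calc _ ≤ K * (x * l^(-(1/2):ℝ)) + x/2 * (l * l^(-(1/2):ℝ)) * (2 * K * l^(-1:ℝ)) := by
          gcongr
          exact hr.trans (by gcongr)
      _ = K * (x * l^(-(1/2):ℝ)) + x * l^(-(1/2):ℝ) * K * (l^(-1:ℝ) * l) := by ring
      _ = 2 * K * (x * l^(-(1/2):ℝ)) := by rw [e4]; ring
      _ = _ := by rw [e3]; ring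
  rw [abs_mul, abs_of_pos hl0] at h3
  exact le_of_mul_le_mul_right h3 hl0

lemma TB_chi_bound : ∃ C : ℝ, 0 < C ∧ ∀ x, Real.exp 1 ≤ x →
    |TB chiB x| ≤ C * (x * Real.log x ^ (-(3/2):ℝ)) := by
  obtain ⟨A, hA0, hA⟩ := SB_half
  obtain ⟨B, hB0, -, hB1⟩ := thB_bounds
  obtain ⟨C, hC0, hC⟩ := basic_est chiB_mul chiB_le hB0.le hB1
  refine ⟨C * A, by positivity, fun x hx => ?_⟩
  have he : (1:ℝ) < Real.exp 1 := by rw [Real.one_lt_exp_iff]; norm_num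
  have hx1 : 1 ≤ x := he.le.trans hx
  have hl1 : 1 ≤ Real.log x := by rwa [Real.le_log_iff_exp_le (by linarith)]
  have h := hC A (1/2) hA0.le (by norm_num) (by norm_num) hA x hx1
  simp only [zero_mul, sub_zero] at h
  set l := Real.log x with hld
  have hl0 : 0 < l := by linarith
  have e3 : l^(-(1/2):ℝ) = l * l^(-(3/2):ℝ) := by
    nth_rewrite 2 [← Real.rpow_one l]
    rw [← Real.rpow_add hl0]; norm_num
  have h2 : (1+l)^(-(1/2):ℝ) ≤ l^(-(1/2):ℝ) := Real.rpow_le_rpow_of_nonpos hl0 (by linarith) (by norm_num)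
  rw [abs_mul, abs_of_pos hl0] at h
  refine le_of_mul_le_mul_right (h.trans ?_) hl0
  calc _ ≤ C * A * (x * l^(-(1/2):ℝ)) := by gcongr
    _ = _ := by rw [e3]; ring

end PartB4

section PartC1

open MeasureTheory Filter Topology

noncomputable def FB (s : ℝ) : ℝ := ∑' n : ℕ, fB n * (n:ℝ)^(-s)

noncomputable def qB (u : ℝ) : ℝ := Real.exp (-u) * SB (Real.exp u)

lemma qB_nonneg (u : ℝ) : 0 ≤ qB u := mul_nonneg (Real.exp_pos _).le (SB_nonneg _)
lemma qB_le (u : ℝ) : qB u ≤ 1 := by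
  unfold qB
  have := SB_le (Real.exp_pos u).le
  calc _ ≤ Real.exp (-u) * Real.exp u := by gcongr
    _ = 1 := by rw [← Real.exp_add]; simp
lemma qB_meas : Measurable qB := by
  unfold qB
  exact (Real.measurable_exp.comp measurable_neg).mul (SB_mono.measurable.comp Real.measurable_exp)

lemma LSeries_FB (s : ℝ) : LSeries (fun n => (fB n : ℂ)) (s : ℂ) = (FB s : ℂ) := by
  unfold LSeries FB
  rw [Complex.ofReal_tsum]
  congr 1
  ext n
  rw [LSeries.term_def]
  split_ifs with h
  · subst h; simp [fB_zero]
  · rw [Complex.ofReal_mul, Complex.ofReal_cpow (Nat.cast_nonneg n)]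
    push_cast
    rw [Complex.cpow_neg, div_eq_mul_inv]

lemma FB_laplace {s : ℝ} (hs : 1 < s) : FB s = s * ∫ u in Set.Ioi (0:ℝ), qB u * Real.exp (-((s-1)*u)) := by
  have hO : (fun n:ℕ ↦ ∑ k ∈ Finset.Icc 1 n, fB k) =O[atTop] fun n:ℕ ↦ (n : ℝ) ^ (1:ℝ) := by
    refine Asymptotics.IsBigO.of_bound 1 (Eventually.of_forall fun n => ?_)
    have := SB_le (x := n) (Nat.cast_nonneg n)
    have h2 := SB_nonneg n
    unfold SB at this h2
    rw [Nat.floor_natCast] at this h2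
    rw [Real.norm_of_nonneg h2, Real.rpow_one, Real.norm_of_nonneg (Nat.cast_nonneg n), one_mul]
    exact this
  have h := LSeries_eq_mul_integral_of_nonneg fB zero_le_one (s := (s:ℂ)) (by simpa using hs) hO fB_nonneg
  rw [LSeries_FB] at h
  have him : Set.Ioi (1:ℝ) = Real.exp '' Set.Ioi 0 := by
    ext x
    simp only [Set.mem_Ioi, Set.mem_image]
    constructor
    · intro h; exact ⟨Real.log x, Real.log_pos h, Real.exp_log (by linarith)⟩
    · rintro ⟨y, hy, rfl⟩; exact Real.one_lt_exp_iff.mpr hy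
  rw [him, integral_image_eq_integral_abs_deriv_smul measurableSet_Ioi
      (fun x _ => (Real.hasDerivAt_exp x).hasDerivWithinAt) Real.exp_injective.injOn] at h
  have e : ∫ u in Set.Ioi (0:ℝ), |Real.exp u| • ((∑ k ∈ Finset.Icc 1 ⌊Real.exp u⌋₊, (fB k : ℂ)) * (Real.exp u : ℂ) ^ (-((s:ℂ) + 1))) =
     ∫ u in Set.Ioi (0:ℝ), ((qB u * Real.exp (-((s-1)*u)) : ℝ) : ℂ) := by
    refine setIntegral_congr_fun measurableSet_Ioi fun u hu => ?_
    rw [abs_of_pos (Real.exp_pos u)]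
    have h1 : (∑ k ∈ Finset.Icc 1 ⌊Real.exp u⌋₊, (fB k : ℂ)) = (SB (Real.exp u) : ℂ) := by
      unfold SB; push_cast; rfl
    have h2 : (Real.exp u : ℂ) ^ (-((s:ℂ) + 1)) = ((Real.exp (-(s+1)*u) : ℝ) : ℂ) := by
      have : (-((s:ℂ) + 1)) = ((-(s+1) : ℝ) : ℂ) := by push_cast; ring
      rw [this, ← Complex.ofReal_cpow (Real.exp_pos u).le, ← Real.exp_mul]
      congr 2; ring
    rw [h1, h2, Complex.real_smul]
    unfold qB
    have h3 : Real.exp (-u) * SB (Real.exp u) * Real.exp (-((s-1)*u)) =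
      Real.exp u * (SB (Real.exp u) * Real.exp (-(s+1)*u)) := by
      have : Real.exp (-u) * Real.exp (-((s-1)*u)) = Real.exp u * Real.exp (-(s+1)*u) := by
        rw [← Real.exp_add, ← Real.exp_add]; congr 1; ring
      linear_combination SB (Real.exp u) * this
    rw [h3]; push_cast; ring
  rw [e, integral_complex_ofReal] at h
  exact_mod_cast h

lemma SB_asymp_all : ∃ c : ℝ, (∃ C : ℝ, 0 < C ∧ ∀ x, Real.exp 1 ≤ x →
      |SB x - c * (x * Real.log x ^ (-(1/2):ℝ))| ≤ C * (x * Real.log x ^ (-(3/2):ℝ))) ∧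
    ∃ C : ℝ, 0 < C ∧ ∀ u, 0 < u → |qB u - c * u ^ (-(1/2):ℝ)| ≤ C * u ^ (-(3/4):ℝ) := by
  obtain ⟨c, C, hC0, hC⟩ := SB_asymp
  refine ⟨c, ⟨C, hC0, hC⟩, C + 1 + |c|, by positivity, fun u hu => ?_⟩
  have hp : 0 < u ^ (-(3/4):ℝ) := by positivity
  rcases le_total 1 u with h | h
  · have h1 := hC (Real.exp u) (Real.exp_le_exp.mpr h)
    rw [Real.log_exp] at h1
    have e : qB u - c * u ^ (-(1/2):ℝ) = Real.exp (-u) * (SB (Real.exp u) - c * (Real.exp u * u ^ (-(1/2):ℝ))) := by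
      unfold qB
      rw [Real.exp_neg]; field_simp
    rw [e, abs_mul, abs_of_pos (Real.exp_pos _)]
    have h2 : u ^ (-(3/2):ℝ) ≤ u ^ (-(3/4):ℝ) := Real.rpow_le_rpow_of_exponent_le h (by norm_num)
    calc _ ≤ Real.exp (-u) * (C * (Real.exp u * u ^ (-(3/2):ℝ))) := by gcongr
      _ = C * u ^ (-(3/2):ℝ) := by rw [Real.exp_neg]; field_simp
      _ ≤ C * u ^ (-(3/4):ℝ) := by gcongr
      _ ≤ _ := by nlinarith [abs_nonneg c]
  · have h1 : u ^ (-(1/2):ℝ) ≤ u ^ (-(3/4):ℝ) := Real.rpow_le_rpow_of_exponent_ge hu h (by norm_num)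
    have h2 : 1 ≤ u ^ (-(3/4):ℝ) := Real.one_le_rpow_of_pos_of_le_one_of_nonpos hu h (by norm_num)
    refine (abs_sub _ _).trans ?_
    rw [abs_mul, abs_of_nonneg (qB_nonneg u), abs_of_pos (show 0 < u ^ (-(1/2):ℝ) by positivity)]
    have := qB_le u
    have := mul_le_mul_of_nonneg_left h1 (abs_nonneg c)
    nlinarith

lemma gamma_int {a δ : ℝ} (ha : 0 < a) (hδ : 0 < δ) :
    IntegrableOn (fun u : ℝ => u^(a-1) * Real.exp (-(δ*u))) (Set.Ioi 0) := by
  have := integrableOn_rpow_mul_exp_neg_mul_rpow (p := 1) (s := a-1) (b := δ) (by linarith) one_pos hδ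
  simpa using this

lemma FB_lim {c : ℝ} (hc : ∃ C : ℝ, 0 < C ∧ ∀ u, 0 < u → |qB u - c * u ^ (-(1/2):ℝ)| ≤ C * u ^ (-(3/4):ℝ)) :
    Tendsto (fun s : ℝ => Real.sqrt (s - 1) * FB s) (𝓝[>] 1) (𝓝 (c * Real.sqrt Real.pi)) := by
  obtain ⟨C, hC0, hC⟩ := hc
  have key : ∀ s : ℝ, 1 < s → |Real.sqrt (s-1) * FB s - s * (c * Real.sqrt Real.pi)| ≤
      s * (C * Real.Gamma (1/4)) * (s-1)^(1/4:ℝ) := by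
    intro s hs
    have hδ : 0 < s - 1 := by linarith
    set δ := s - 1 with hδd
    have i1 := gamma_int (a := 1/2) (by norm_num) hδ
    have i2 := gamma_int (a := 1/4) (by norm_num) hδ
    have i0 : IntegrableOn (fun u : ℝ => qB u * Real.exp (-(δ*u))) (Set.Ioi 0) := by
      have i := gamma_int (a := 1) (by norm_num) hδ
      simp only [sub_self, Real.rpow_zero, one_mul] at i
      refine Integrable.bdd_mul (c := 1) i qB_meas.aestronglyMeasurable (Eventually.of_forall fun u => ?_)
      rw [Real.norm_of_nonneg (qB_nonneg u)]; exact qB_le u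
    have g1 := Real.integral_rpow_mul_exp_neg_mul_Ioi (a := 1/2) (r := δ) (by norm_num) hδ
    have g2 := Real.integral_rpow_mul_exp_neg_mul_Ioi (a := 1/4) (r := δ) (by norm_num) hδ
    have h1 : ‖∫ u in Set.Ioi (0:ℝ), (qB u * Real.exp (-(δ*u)) - c * (u^((1/2:ℝ)-1) * Real.exp (-(δ*u))))‖ ≤
       ∫ u in Set.Ioi (0:ℝ), C * (u^((1/4:ℝ)-1) * Real.exp (-(δ*u))) := by
      refine norm_integral_le_of_norm_le (i2.const_mul C) ?_
      refine (ae_restrict_iff' measurableSet_Ioi).mpr (Eventually.of_forall fun u hu => ?_)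
      have h2 := hC u hu
      have e : qB u * Real.exp (-(δ*u)) - c * (u^((1/2:ℝ)-1) * Real.exp (-(δ*u))) =
         (qB u - c * u ^ (-(1/2):ℝ)) * Real.exp (-(δ*u)) := by
        have : ((1/2:ℝ)-1) = -(1/2) := by norm_num
        rw [this]; ring
      have e2 : ((1/4:ℝ)-1) = -(3/4) := by norm_num
      rw [e, e2, norm_mul, Real.norm_eq_abs, Real.norm_of_nonneg (Real.exp_pos _).le, ← mul_assoc]
      gcongr
    rw [integral_sub i0 (i1.const_mul c), integral_const_mul, integral_const_mul, g1, g2, Real.norm_eq_abs,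
      Real.Gamma_one_half_eq] at h1
    rw [FB_laplace hs, ← hδd]
    set Q := ∫ u in Set.Ioi (0:ℝ), qB u * Real.exp (-(δ*u)) with hQ
    have e1 : Real.sqrt δ * (1/δ)^(1/2:ℝ) = 1 := by
      rw [Real.sqrt_eq_rpow, ← Real.mul_rpow hδ.le (by positivity), mul_one_div_cancel hδ.ne', Real.one_rpow]
    have e2 : Real.sqrt δ * (1/δ)^(1/4:ℝ) = δ^(1/4:ℝ) := by
      rw [Real.sqrt_eq_rpow, one_div δ, Real.inv_rpow hδ.le, ← Real.rpow_neg hδ.le, ← Real.rpow_add hδ]; norm_num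
    have e3 : Real.sqrt δ * (s * Q) - s * (c * Real.sqrt Real.pi) =
       (s * Real.sqrt δ) * (Q - c * ((1/δ)^(1/2:ℝ) * Real.sqrt Real.pi)) := by
      linear_combination s * c * Real.sqrt Real.pi * e1
    have hsn := Real.sqrt_nonneg δ
    rw [e3, abs_mul, abs_of_nonneg (show 0 ≤ s * Real.sqrt δ by positivity)]
    calc _ ≤ (s * Real.sqrt δ) * (C * ((1/δ)^(1/4:ℝ) * Real.Gamma (1/4))) := by gcongr
      _ = s * (C * Real.Gamma (1/4)) * (Real.sqrt δ * (1/δ)^(1/4:ℝ)) := by ring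
      _ = _ := by rw [e2]
  have t1 : Tendsto (fun s : ℝ => s * (C * Real.Gamma (1/4)) * (s-1)^(1/4:ℝ)) (𝓝[>] 1) (𝓝 0) := by
    have hc : Continuous fun s : ℝ => s * (C * Real.Gamma (1/4)) * (s-1)^(1/4:ℝ) := by
      refine (continuous_id.mul continuous_const).mul ?_
      exact (continuous_id.sub continuous_const).rpow_const fun _ => Or.inr (by norm_num)
    have := hc.tendsto 1
    simp only [sub_self] at this
    rw [Real.zero_rpow (by norm_num), mul_zero] at this
    exact this.mono_left nhdsWithin_le_nhds
  have t2 : Tendsto (fun s : ℝ => Real.sqrt (s-1) * FB s - s * (c * Real.sqrt Real.pi)) (𝓝[>] 1) (𝓝 0) := by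
    refine squeeze_zero_norm' ?_ t1
    filter_upwards [self_mem_nhdsWithin] with s hs
    exact key s hs
  have t3 : Tendsto (fun s : ℝ => s * (c * Real.sqrt Real.pi)) (𝓝[>] 1) (𝓝 (1 * (c * Real.sqrt Real.pi))) :=
    ((continuous_id.mul continuous_const).tendsto 1).mono_left nhdsWithin_le_nhds
  have := t2.add t3
  simpa using this

end PartC1

lemma jac_iff {p : ℕ} (hp : Odd p) : jacobiSym 2 p = 1 ↔ (p % 8 = 1 ∨ p % 8 = 7) := by
  rw [jacobiSym.at_two hp, ZMod.χ₈_nat_eq_if_mod_eight]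
  have := Nat.odd_iff.mp hp
  split_ifs <;> simp_all

lemma fB_even {n : ℕ} (h : 2 ∣ n) : fB n = 0 := by
  unfold fB
  rw [if_neg]
  rintro ⟨-, h2⟩
  have := h2 2 Nat.prime_two h
  omega

open Classical in
lemma ind_eq (d : ℕ) (hd : 1 ≤ d) : (if d ∈ Dtwo then (1:ℝ) else 0) =
    (if 2 ∣ d then fB (d/2) else 0) + (fB d - hB chiB d) / 2 := by
  unfold hB
  by_cases h2 : 2 ∣ d
  · rw [if_pos h2, fB_even h2]
    obtain ⟨m, rfl⟩ := h2
    rw [Nat.mul_div_cancel_left _ two_pos]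
    have hiff : (2*m ∈ Dtwo) ↔ (Squarefree m ∧ ∀ p : ℕ, p.Prime → p ∣ m → (p % 8 = 1 ∨ p % 8 = 7)) := by
      unfold Dtwo
      constructor
      · rintro ⟨h1, hs, -, h3⟩
        have hm : ¬ 2 ∣ m := by
          intro hdv
          have := hs 2 (mul_dvd_mul_left 2 hdv)
          exact absurd (Nat.isUnit_iff.mp this) (by norm_num)
        refine ⟨hs.of_mul_right, fun p hp hpm => ?_⟩
        have hodd : Odd p := hp.odd_of_ne_two (by rintro rfl; exact hm hpm)
        exact (jac_iff hodd).mp (h3 p hp hodd (hpm.mul_left 2))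
      · rintro ⟨hs, h3⟩
        have hm : ¬ 2 ∣ m := by
          intro hdv
          have := h3 2 Nat.prime_two hdv
          omega
        refine ⟨by omega, ?_, by omega, fun p hp hodd hpm => ?_⟩
        · rw [Nat.squarefree_mul ((Nat.Prime.coprime_iff_not_dvd Nat.prime_two).mpr hm)]
          exact ⟨Nat.prime_two.squarefree, hs⟩
        · rcases (hp.dvd_mul).mp hpm with h | h
          · rw [(Nat.prime_dvd_prime_iff_eq hp Nat.prime_two).mp h] at hodd
            exact absurd hodd (by decide)
          · exact (jac_iff hodd).mpr (h3 p hp h)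
    unfold fB
    by_cases h : (2*m ∈ Dtwo)
    · rw [if_pos h, if_pos (hiff.mp h)]; ring
    · rw [if_neg h, if_neg (fun h' => h (hiff.mpr h'))]; ring
  · rw [if_neg h2, zero_add]
    by_cases h1 : d % 4 = 1
    · have : d ∉ Dtwo := fun h => h.2.2.1 h1
      rw [if_neg this]
      unfold chiB
      rw [ZMod.χ₄_nat_one_mod_four h1]; simp
    · have h3 : d % 4 = 3 := by omega
      have hc : chiB d = -1 := by unfold chiB; rw [ZMod.χ₄_nat_three_mod_four h3]; simp
      rw [hc]
      have hiff : (d ∈ Dtwo) ↔ (Squarefree d ∧ ∀ p : ℕ, p.Prime → p ∣ d → (p % 8 = 1 ∨ p % 8 = 7)) := by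
        unfold Dtwo
        constructor
        · rintro ⟨-, hs, -, h3⟩
          refine ⟨hs, fun p hp hpm => ?_⟩
          have hodd : Odd p := hp.odd_of_ne_two (by rintro rfl; exact h2 hpm)
          exact (jac_iff hodd).mp (h3 p hp hodd hpm)
        · rintro ⟨hs, h4⟩
          exact ⟨by omega, hs, h1, fun p hp hodd hpm => (jac_iff hodd).mpr (h4 p hp hpm)⟩
      unfold fB
      by_cases h : (d ∈ Dtwo)
      · rw [if_pos h, if_pos (hiff.mp h)]; ring
      · rw [if_neg h, if_neg (fun h' => h (hiff.mpr h'))]; ring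

open Classical in
lemma card_eq {X : ℝ} (hX : 0 ≤ X) : (Nat.card {d : ℕ | d ∈ Dtwo ∧ (d : ℝ) ≤ X} : ℝ) =
    SB (X/2) + (SB X - TB chiB X) / 2 := by
  have h1 : {d : ℕ | d ∈ Dtwo ∧ (d : ℝ) ≤ X} = ((Finset.Icc 1 ⌊X⌋₊).filter (· ∈ Dtwo) : Finset ℕ) := by
    ext d
    simp only [Set.mem_ofPred_eq, Finset.coe_filter, Finset.mem_Icc]
    rw [Nat.le_floor_iff hX]
    constructor
    · rintro ⟨a, b⟩; exact ⟨⟨a.1.le, b⟩, a⟩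
    · rintro ⟨⟨_, b⟩, a⟩; exact ⟨a, b⟩
  rw [h1, Nat.card_coe_set_eq, Set.ncard_coe_finset, Finset.card_filter]
  push_cast
  rw [Finset.sum_congr rfl fun d hd => ind_eq d (Finset.mem_Icc.mp hd).1, Finset.sum_add_distrib, ← Finset.sum_div,
    Finset.sum_sub_distrib]
  congr 1
  unfold SB
  have e : ⌊X/2⌋₊ = ⌊X⌋₊ / 2 := by
    have := Nat.floor_div_natCast X 2
    simpa using this
  rw [e, ← Finset.sum_filter]
  symm
  refine Finset.sum_bij (fun k _ => 2 * k) ?_ ?_ ?_ ?_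
  · intro k hk
    simp only [Finset.mem_Icc, Finset.mem_filter] at hk ⊢
    omega
  · intro a _ b _ h
    have h' : 2 * a = 2 * b := h
    omega
  · intro m hm
    simp only [Finset.mem_Icc, Finset.mem_filter] at hm
    obtain ⟨⟨a, b⟩, k, rfl⟩ := hm
    exact ⟨k, by simp only [Finset.mem_Icc]; omega, rfl⟩
  · intro k _
    rw [Nat.mul_div_cancel_left _ two_pos]

lemma FB_summable {s : ℝ} (hs : 1 < s) : Summable fun n : ℕ => ‖fB n * (n:ℝ)^(-s)‖ := by
  have h := Real.summable_nat_rpow.mpr (show -s < -1 by linarith)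
  refine Summable.of_nonneg_of_le (fun n => norm_nonneg _) (fun n => ?_) h
  rw [norm_mul, Real.norm_of_nonneg (fB_nonneg n), Real.norm_of_nonneg (by positivity)]
  have : 0 ≤ (n:ℝ)^(-s) := by positivity
  nlinarith [fB_le_one n]

lemma euler {s : ℝ} (hs : 1 < s) :
    ∏' p : {p : ℕ // p.Prime ∧ (p = 2 ∨ jacobiSym 2 p = 1)}, (1 + (p.1 : ℝ) ^ (-s)) = (1 + (2:ℝ)^(-s)) * FB s := by
  have h := EulerProduct.eulerProduct_hasProd (f := fun n : ℕ => fB n * (n:ℝ)^(-s)) (by simp [fB_one])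
    (by
      intro m n hmn
      rw [fB_mul hmn]; push_cast
      rw [Real.mul_rpow (by positivity) (by positivity)]; ring) (FB_summable hs) (by simp [fB_zero])
  have e : ∀ p : Nat.Primes, ∑' e : ℕ, fB ((p:ℕ)^e) * (((p:ℕ)^e : ℕ):ℝ)^(-s) = 1 + fB p * (p:ℝ)^(-s) := by
    intro p
    rw [tsum_eq_sum (s := Finset.range 2)]
    · simp [Finset.sum_range_succ, fB_one]
    · intro k hk
      rw [Finset.mem_range, not_lt] at hk
      rw [fB_eq_zero, zero_mul]
      intro hsq
      have := hsq p (by rw [← pow_two]; exact pow_dvd_pow _ hk)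
      exact absurd (Nat.isUnit_iff.mp this) p.2.one_lt.ne'
  simp_rw [e] at h
  let p2 : Nat.Primes := ⟨2, Nat.prime_two⟩
  have hs2 : HasProd (fun p : Nat.Primes => if p = p2 then (1 + (2:ℝ)^(-s)) else 1) (1 + (2:ℝ)^(-s)) :=
    hasProd_ite_eq p2 _
  have hm := hs2.mul h
  let i : {p : ℕ // p.Prime ∧ (p = 2 ∨ jacobiSym 2 p = 1)} → Nat.Primes := fun p => ⟨p.1, p.2.1⟩
  have hinj : Function.Injective i := by
    intro a b hab
    apply Subtype.ext
    have := congrArg (fun q : Nat.Primes => (q:ℕ)) hab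
    exact this
  have f2 : fB 2 = 0 := fB_even dvd_rfl
  have hm2 := (Function.Injective.hasProd_iff hinj ?_).mpr hm
  · have hf : ((fun p : Nat.Primes => (if p = p2 then (1 + (2:ℝ)^(-s)) else 1) * (1 + fB p * (p:ℝ)^(-s))) ∘ i)
        = fun p => (1 + (p.1 : ℝ) ^ (-s)) := by
      funext p
      obtain ⟨p, hp, hp'⟩ := p
      show (if i ⟨p, hp, hp'⟩ = p2 then (1 + (2:ℝ)^(-s)) else 1) * (1 + fB p * (p:ℝ)^(-s)) = 1 + (p:ℝ)^(-s)
      by_cases h2 : p = 2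
      · subst h2
        have : i ⟨2, hp, hp'⟩ = p2 := rfl
        rw [if_pos this, f2]; simp
      · have : i ⟨p, hp, hp'⟩ ≠ p2 := fun h => h2 (congrArg (fun q : Nat.Primes => (q:ℕ)) h)
        have hj := (jac_iff (hp.odd_of_ne_two h2)).mp (hp'.resolve_left h2)
        rw [if_neg this, fB_prime hp, if_pos hj]; ring
    rw [hf] at hm2
    exact hm2.tprod_eq
  · intro p hp
    have hp2 : p ≠ p2 := by
      rintro rfl
      exact hp ⟨⟨2, Nat.prime_two, Or.inl rfl⟩, rfl⟩
    have hodd : Odd (p:ℕ) := p.2.odd_of_ne_two (fun h => hp2 (Subtype.ext h))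
    have : ¬ ((p:ℕ) % 8 = 1 ∨ (p:ℕ) % 8 = 7) := by
      intro h
      exact hp ⟨⟨p, p.2, Or.inr ((jac_iff hodd).mpr h)⟩, rfl⟩
    rw [if_neg hp2, fB_prime p.2, if_neg this]; simp

lemma rpow_half {t : ℝ} (ht : 0 < t) : t ^ (-(1/2):ℝ) = (Real.sqrt t)⁻¹ := by
  rw [Real.rpow_neg ht.le, Real.sqrt_eq_rpow]

lemma rpow_threehalf {t : ℝ} (ht : 0 < t) : t ^ ((3:ℝ)/2) = (Real.sqrt t)^3 := by
  rw [Real.sqrt_eq_rpow, ← Real.rpow_natCast, ← Real.rpow_mul ht.le]; norm_num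

lemma rpow_neg_threehalf {t : ℝ} (ht : 0 < t) : t ^ (-(3/2):ℝ) = ((Real.sqrt t)^3)⁻¹ := by
  rw [Real.rpow_neg ht.le, rpow_threehalf ht]

lemma inv_sqrt_bounds {m l : ℝ} (hl : 0 < l) (hm : l / 2 ≤ m) (hml : l - 1 ≤ m) (hm' : m ≤ l) :
    |(Real.sqrt m)⁻¹ - (Real.sqrt l)⁻¹| ≤ 2 * ((Real.sqrt l)^3)⁻¹ ∧
    ((Real.sqrt m)^3)⁻¹ ≤ 8 * ((Real.sqrt l)^3)⁻¹ := by
  have hm0 : 0 < m := by linarith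
  have ha := Real.sqrt_pos.mpr hm0
  have hb := Real.sqrt_pos.mpr hl
  have ha2 := Real.sq_sqrt hm0.le
  have hb2 := Real.sq_sqrt hl.le
  have hab := Real.sqrt_le_sqrt hm'
  set a := Real.sqrt m
  set b := Real.sqrt l
  have h2a : b ≤ 2 * a := by nlinarith
  constructor
  · have e : a⁻¹ - b⁻¹ = (b - a) / (a * b) := by field_simp
    rw [e, abs_of_nonneg (by apply div_nonneg <;> [linarith; positivity]), ← div_eq_mul_inv,
      div_le_div_iff₀ (by positivity) (by positivity)]
    have h1 : (b - a) * b ≤ 1 := by nlinarith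
    have h1' : 0 ≤ b^2 := by positivity
    nlinarith [mul_le_mul_of_nonneg_right h1 h1', mul_pos ha hb]
  · rw [← div_eq_mul_inv, inv_eq_one_div, div_le_div_iff₀ (by positivity) (by positivity)]
    have := pow_le_pow_left₀ hb.le h2a 3
    nlinarith

/-- `|D₂(X)| = (2C₂/3)·X/√(log X) + O(X/(log X)^{3/2})`, where
`C₂ = π^{-1/2} lim_{s→1⁺} √(s-1) ∏_{p ∈ P₂} (1 + p^{-s})` and `P₂` is the set of primes
`p` with `p = 2` or `(2/p) = 1`. -/
theorem stmt7 (C₂ : ℝ)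
    (hC : Tendsto
      (fun s : ℝ => Real.sqrt (s - 1) *
        ∏' p : {p : ℕ // p.Prime ∧ (p = 2 ∨ jacobiSym 2 p = 1)}, (1 + (p.1 : ℝ) ^ (-s)))
      (nhdsWithin 1 (Set.Ioi 1)) (nhds (Real.sqrt Real.pi * C₂))) :
    (fun X : ℝ =>
        (Nat.card {d : ℕ | d ∈ Dtwo ∧ (d : ℝ) ≤ X} : ℝ) -
          (2 * C₂ / 3) * X / Real.sqrt (Real.log X))
      =O[atTop] fun X : ℝ => X / Real.log X ^ ((3 : ℝ) / 2) := by
  obtain ⟨c, ⟨C, hC0, hS⟩, hq⟩ := SB_asymp_all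
  obtain ⟨C', hC'0, hT⟩ := TB_chi_bound
  have hlim := FB_lim hq
  have h2 : Tendsto (fun s : ℝ => 1 + (2:ℝ)^(-s)) (nhdsWithin 1 (Set.Ioi 1)) (nhds (3/2)) := by
    have : ContinuousAt (fun s : ℝ => 1 + (2:ℝ)^(-s)) 1 := by
      refine continuousAt_const.add ?_
      exact ContinuousAt.rpow continuousAt_const continuousAt_id.neg (Or.inl (by norm_num))
    have h := this.tendsto
    have e : 1 + (2:ℝ)^(-(1:ℝ)) = 3/2 := by rw [Real.rpow_neg_one]; norm_num
    simp only [e] at h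
    exact h.mono_left nhdsWithin_le_nhds
  have h3 := h2.mul hlim
  have h4 : Real.sqrt Real.pi * C₂ = 3/2 * (c * Real.sqrt Real.pi) := by
    refine tendsto_nhds_unique hC (h3.congr' ?_)
    filter_upwards [self_mem_nhdsWithin] with s hs
    rw [euler hs]; ring
  have hpi : 0 < Real.sqrt Real.pi := Real.sqrt_pos.mpr Real.pi_pos
  have hc : 2 * C₂ / 3 = c := by
    have : Real.sqrt Real.pi * C₂ = Real.sqrt Real.pi * (3/2*c) := by rw [h4]; ring
    have := mul_left_cancel₀ hpi.ne' this
    rw [this]; ring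
  rw [hc]
  refine IsBigO.of_bound (|c| + 5 * C + C') ?_
  filter_upwards [eventually_ge_atTop (2 * Real.exp 1)] with X hX
  have he := Real.exp_one_gt_d9
  have hX0 : 0 < X := by linarith
  have hX1 : Real.exp 1 ≤ X := by linarith
  have hX2 : Real.exp 1 ≤ X/2 := by linarith
  have hl2 : 1 ≤ Real.log (X/2) := by
    rw [Real.le_log_iff_exp_le (by linarith)]; exact hX2
  have hlog : Real.log (X/2) = Real.log X - Real.log 2 := Real.log_div hX0.ne' two_ne_zero
  have hlt := Real.log_two_lt_d9
  have hgt := Real.log_two_gt_d9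
  have hl : 0 < Real.log X := by linarith
  have hm0 : 0 < Real.log (X/2) := by linarith
  obtain ⟨b1, b2⟩ := inv_sqrt_bounds hl (m := Real.log (X/2)) (by linarith) (by linarith) (by linarith)
  have s1 := hS X hX1
  have s2 := hS (X/2) hX2
  have s3 := hT X hX1
  rw [rpow_half hl, rpow_neg_threehalf hl] at s1
  rw [rpow_half hm0, rpow_neg_threehalf hm0] at s2
  rw [rpow_neg_threehalf hl] at s3
  rw [card_eq hX0.le, rpow_threehalf hl, Real.norm_eq_abs, Real.norm_of_nonneg (by positivity), div_eq_mul_inv (c * X),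
    div_eq_mul_inv X (_ ^ 3)]
  set B := (Real.sqrt (Real.log X))⁻¹
  set A := (Real.sqrt (Real.log (X/2)))⁻¹
  set E := (Real.sqrt (Real.log X) ^ 3)⁻¹
  set G := (Real.sqrt (Real.log (X/2)) ^ 3)⁻¹
  have hE : 0 ≤ E := by positivity
  have k1 : |c * (X/2) * (A - B)| ≤ |c| * (X/2) * (2 * E) := by
    rw [abs_mul, abs_mul, abs_of_pos (show 0 < X/2 by linarith)]
    gcongr
  have k2 : C * (X/2 * G) ≤ C * (X/2 * (8 * E)) := by gcongr
  have hXE : 0 ≤ X * E := by positivity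
  have k3 : 0 ≤ C * (X * E) := by positivity
  have k4 : 0 ≤ C' * (X * E) := by positivity
  rw [abs_le] at *
  constructor <;> linarith [s1.1, s1.2, s2.1, s2.2, s3.1, s3.2, k1.1, k1.2]
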